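/- arXiv:math/0509179 — 4 statements merged into one kernel-verified Lean document; each statement's English description precedes it below -/
import Mathlib

section
/- Let n ≥ 1 and let p : ℝ^n → ℝ^n be a continuous ℤ^n-periodic map (a continuous 1-form on the torus 𝕋^n = ℝ^n/ℤ^n, which is the total space of a circle fibration over 𝕋^{n−1}). Assume p is NOT closed in the sense of distributions, i.e. there exist a smooth compactly supported φ : ℝ^n → ℝ and indices i, j with ∫_{ℝ^n} (p_j ∂_i φ − p_i ∂_j φ) dx ≠ 0. Then there exists a smooth ℤ^n-periodic function f : ℝ^n → ℝ such that p(x) − ∇f(x) ≠ 0 for every x ∈ ℝ^n. -/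
open Set Function MeasureTheory

noncomputable section

/-- A map on `ℝ^n` is `ℤ^n`-periodic if it is invariant under all integer translations;
such maps correspond to objects on the torus `𝕋^n = ℝ^n/ℤ^n`. -/
def ZPeriodic {n : ℕ} {α : Type*} (f : (Fin n → ℝ) → α) : Prop :=
  ∀ (k : Fin n → ℤ) (x : Fin n → ℝ), f (x + fun i => (k i : ℝ)) = f x

/-- A continuous map `p : ℝ^n → ℝ^n`, viewed as the 1-form `Σ_i p_i dx_i`, is closed in
the sense of distributions if `∫ (p_j ∂_i φ − p_i ∂_j φ) = 0` for every smooth compactly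
supported test function `φ` and all indices `i, j`. -/
def IsDistribClosed {n : ℕ} (p : (Fin n → ℝ) → (Fin n → ℝ)) : Prop :=
  ∀ φ : (Fin n → ℝ) → ℝ, ContDiff ℝ (⊤ : ℕ∞) φ → HasCompactSupport φ →
    ∀ i j : Fin n,
      ∫ x : Fin n → ℝ,
        (p x j * fderiv ℝ φ x (Pi.single i 1) - p x i * fderiv ℝ φ x (Pi.single j 1)) = 0

open UnitAddTorus

/-- The quotient map `ℝ^n → 𝕋^n`. -/
def torusMk {n : ℕ} (x : Fin n → ℝ) : UnitAddTorus (Fin n) := fun i => (x i : UnitAddCircle)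

lemma torusMk_add {n : ℕ} (x y : Fin n → ℝ) : torusMk (x + y) = torusMk x + torusMk y := rfl

lemma torusMk_intCast {n : ℕ} (k : Fin n → ℤ) : torusMk (fun i => (k i : ℝ)) = 0 := by
  funext i
  exact (AddCircle.coe_eq_zero_iff 1).2 ⟨k i, by simp⟩

lemma isOpenQuotientMap_torusMk {n : ℕ} : IsOpenQuotientMap (torusMk (n := n)) :=
  IsOpenQuotientMap.piMap (f := fun (_ : Fin n) (x : ℝ) => (x : UnitAddCircle))
    fun _ => QuotientAddGroup.isOpenQuotientMap_mk

lemma continuous_torusMk {n : ℕ} : Continuous (torusMk (n := n)) :=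
  isOpenQuotientMap_torusMk.continuous

lemma torusMk_eq_torusMk_iff {n : ℕ} {x y : Fin n → ℝ} :
    torusMk x = torusMk y ↔ ∃ k : Fin n → ℤ, y = x + fun i => (k i : ℝ) := by
  constructor
  · intro h
    have h' : ∀ i, ∃ k : ℤ, y i = x i + k := fun i => by
      have hi : ((y i - x i : ℝ) : UnitAddCircle) = 0 := by
        rw [AddCircle.coe_sub, sub_eq_zero]
        exact (congrFun h i).symm
      obtain ⟨k, hk⟩ := (AddCircle.coe_eq_zero_iff 1).1 hi
      exact ⟨k, by rw [zsmul_one] at hk; linarith⟩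
    choose k hk using h'
    exact ⟨k, funext hk⟩
  · rintro ⟨k, rfl⟩
    rw [torusMk_add, torusMk_intCast, add_zero]

lemma ZPeriodic.comp_torusMk {n : ℕ} {α : Type*} (f : UnitAddTorus (Fin n) → α) :
    ZPeriodic (fun x => f (torusMk x)) := fun k x => by
  simp only [torusMk_add, torusMk_intCast, add_zero]

lemma ZPeriodic.exists_lift {n : ℕ} {α : Type*} [TopologicalSpace α] {f : (Fin n → ℝ) → α}
    (hf : Continuous f) (hper : ZPeriodic f) :
    ∃ g : C(UnitAddTorus (Fin n), α), ∀ x, g (torusMk x) = f x := by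
  have hfac : FactorsThrough f (torusMk (n := n)) := fun x y h => by
    obtain ⟨k, rfl⟩ := torusMk_eq_torusMk_iff.1 h
    exact (hper k x).symm
  refine ⟨⟨fun z => f (surjInv isOpenQuotientMap_torusMk.surjective z), ?_⟩, fun x => ?_⟩
  · rw [isOpenQuotientMap_torusMk.continuous_comp_iff.symm]
    refine hf.congr fun x => ?_
    exact hfac (surjInv_eq _ _).symm
  · exact hfac (surjInv_eq _ _)

lemma mFourier_torusMk {n : ℕ} (m : Fin n → ℤ) (x : Fin n → ℝ) :
    mFourier m (torusMk x) = Complex.exp (2 * Real.pi * Complex.I * (∑ i, m i * x i : ℝ)) := by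
  simp only [mFourier, ContinuousMap.coe_mk, torusMk, fourier_coe_apply, ← Complex.exp_sum,
    Complex.ofReal_sum, Finset.mul_sum]
  congr 1
  refine Finset.sum_congr rfl fun i _ => ?_
  push_cast
  ring

lemma mFourier_add_right {n : ℕ} (m : Fin n → ℤ) (z w : UnitAddTorus (Fin n)) :
    mFourier m (z + w) = mFourier m z * mFourier m w := by
  obtain ⟨x, rfl⟩ := isOpenQuotientMap_torusMk.surjective z
  obtain ⟨y, rfl⟩ := isOpenQuotientMap_torusMk.surjective w
  rw [← torusMk_add, mFourier_torusMk, mFourier_torusMk, mFourier_torusMk, ← Complex.exp_add]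
  congr 1
  simp only [Pi.add_apply, mul_add, Finset.sum_add_distrib, Complex.ofReal_add]

lemma hasFDerivAt_mFourier_torusMk {n : ℕ} (m : Fin n → ℤ) (x : Fin n → ℝ) :
    HasFDerivAt (fun y => mFourier m (torusMk y))
      (mFourier m (torusMk x) • (2 * Real.pi * Complex.I : ℂ) •
        (Complex.ofRealCLM ∘L (∑ i, (m i : ℝ) • ContinuousLinearMap.proj (R := ℝ) i))) x := by
  have h : HasFDerivAt (fun y : Fin n → ℝ => 2 * Real.pi * Complex.I *
      ((∑ i, m i * y i : ℝ) : ℂ)) ((2 * Real.pi * Complex.I : ℂ) •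
        (Complex.ofRealCLM ∘L (∑ i, (m i : ℝ) • ContinuousLinearMap.proj (R := ℝ) i))) x := by
    refine (HasFDerivAt.const_mul ?_ _)
    convert! (Complex.ofRealCLM ∘L
      (∑ i, (m i : ℝ) • ContinuousLinearMap.proj (R := ℝ) (φ := fun _ : Fin n => ℝ) i)).hasFDerivAt
      using 1
    ext y
    simp
  have h' := h.cexp
  rw [← mFourier_torusMk] at h'
  refine h'.congr_of_eventuallyEq (.of_forall fun y => ?_)
  exact mFourier_torusMk m y

lemma contDiff_mFourier_torusMk {n : ℕ} (m : Fin n → ℤ) :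
    ContDiff ℝ (⊤ : ℕ∞) (fun x => mFourier m (torusMk x)) := by
  have h : ContDiff ℝ (⊤ : ℕ∞) (fun x : Fin n → ℝ => ∑ i, (m i : ℝ) * x i) := by fun_prop
  simp only [mFourier_torusMk]
  exact (contDiff_const.mul (Complex.ofRealCLM.contDiff.comp h)).cexp

lemma fderiv_mFourier_torusMk {n : ℕ} (m : Fin n → ℤ) (x v : Fin n → ℝ) :
    fderiv ℝ (fun y => mFourier m (torusMk y)) x v =
      2 * Real.pi * Complex.I * (∑ i, m i * v i : ℝ) * mFourier m (torusMk x) := by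
  rw [(hasFDerivAt_mFourier_torusMk m x).fderiv]
  simp
  ring

lemma mFourier_torusMk_add_smul {n : ℕ} (m k : Fin n → ℤ) (x : Fin n → ℝ) (t : ℝ) :
    mFourier m (torusMk (x + t • fun i => (k i : ℝ))) =
      mFourier m (torusMk x) *
        Complex.exp (2 * Real.pi * Complex.I * (∑ i, m i * k i : ℤ) * t) := by
  rw [torusMk_add, mFourier_add_right, mFourier_torusMk m (t • _)]
  congr 2
  push_cast
  rw [Finset.mul_sum, Finset.mul_sum, Finset.sum_mul]
  refine Finset.sum_congr rfl fun i _ => ?_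
  simp
  ring

lemma integral_mFourier_torusMk_line {n : ℕ} (m k : Fin n → ℤ) (x : Fin n → ℝ) :
    ∫ t in (0 : ℝ)..1, mFourier m (torusMk (x + t • fun i => (k i : ℝ))) =
      if ∑ i, m i * k i = 0 then mFourier m (torusMk x) else 0 := by
  simp only [mFourier_torusMk_add_smul]
  split_ifs with h
  · simp [h]
  · have hc : (2 * Real.pi * Complex.I * (∑ i, m i * k i : ℤ) : ℂ) ≠ 0 :=
      mul_ne_zero Complex.two_pi_I_ne_zero (Int.cast_ne_zero.2 h)
    rw [intervalIntegral.integral_const_mul, integral_exp_mul_complex hc]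
    have h1 : Complex.exp (2 * Real.pi * Complex.I * (∑ i, m i * k i : ℤ)) = 1 := by
      rw [mul_comm, Complex.exp_int_mul_two_pi_mul_I]
    simp only [Complex.ofReal_one, mul_one, h1, Complex.ofReal_zero, mul_zero, Complex.exp_zero,
      sub_self, zero_div]

lemma exists_primitive_of_mem_span_mFourier {n : ℕ} (k : Fin n → ℤ)
    {Q : C(UnitAddTorus (Fin n), ℂ)} (hQ : Q ∈ Submodule.span ℂ (range mFourier)) :
    ∃ f : (Fin n → ℝ) → ℂ, ContDiff ℝ (⊤ : ℕ∞) f ∧ ZPeriodic f ∧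
      ∀ x, Q (torusMk x) - ∫ t in (0 : ℝ)..1, Q (torusMk (x + t • fun i => (k i : ℝ))) =
        fderiv ℝ f x (fun i => (k i : ℝ)) := by
  have hint : ∀ (R : C(UnitAddTorus (Fin n), ℂ)) (x v : Fin n → ℝ), IntervalIntegrable
      (fun t : ℝ => R (torusMk (x + t • v))) volume 0 1 := fun R x v =>
    (R.continuous.comp (continuous_torusMk.comp (by fun_prop))).intervalIntegrable _ _
  induction hQ using Submodule.span_induction with
  | mem Q hQ =>
    obtain ⟨m, rfl⟩ := hQ
    simp only [integral_mFourier_torusMk_line]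
    split_ifs with h
    · exact ⟨0, contDiff_const, fun _ _ => rfl, fun x => by simp⟩
    · have hc : (2 * Real.pi * Complex.I * (∑ i, m i * k i : ℤ) : ℂ) ≠ 0 :=
        mul_ne_zero Complex.two_pi_I_ne_zero (Int.cast_ne_zero.2 h)
      refine ⟨fun x => (2 * Real.pi * Complex.I * (∑ i, m i * k i : ℤ) : ℂ)⁻¹ *
        mFourier m (torusMk x), contDiff_const.mul (contDiff_mFourier_torusMk m),
        ZPeriodic.comp_torusMk (fun z => (2 * Real.pi * Complex.I * (∑ i, m i * k i : ℤ) : ℂ)⁻¹ *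
        mFourier m z), fun x => ?_⟩
      rw [fderiv_const_mul (hasFDerivAt_mFourier_torusMk m x).differentiableAt,
        smul_apply, fderiv_mFourier_torusMk, sub_zero, smul_eq_mul]
      push_cast at hc ⊢
      exact (inv_mul_cancel_left₀ hc _).symm
  | zero => exact ⟨0, contDiff_const, fun _ _ => rfl, fun x => by simp⟩
  | add Q R _ _ hQ hR =>
    obtain ⟨f, hf, hfp, hfd⟩ := hQ
    obtain ⟨g, hg, hgp, hgd⟩ := hR
    refine ⟨f + g, hf.add hg, fun k x => by simp [hfp k x, hgp k x], fun x => ?_⟩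
    simp only [ContinuousMap.add_apply]
    rw [fderiv_add (hf.differentiable (by simp) x) (hg.differentiable (by simp) x),
      add_apply, ← hfd, ← hgd, intervalIntegral.integral_add (hint Q x _) (hint R x _)]
    ring
  | smul c Q _ hQ =>
    obtain ⟨f, hf, hfp, hfd⟩ := hQ
    refine ⟨c • f, contDiff_const.smul hf, fun k x => by simp [hfp k x], fun x => ?_⟩
    simp only [ContinuousMap.smul_apply]
    rw [fderiv_const_smul (hf.differentiable (by simp) x), smul_apply, ← hfd,
      intervalIntegral.integral_smul, smul_sub]

lemma exists_smooth_primitive_approx {n : ℕ} {P : (Fin n → ℝ) → ℝ} (hP : Continuous P)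
    (hper : ZPeriodic P) (k : Fin n → ℤ) {ε : ℝ} (hε : 0 < ε) :
    ∃ f : (Fin n → ℝ) → ℝ, ContDiff ℝ (⊤ : ℕ∞) f ∧ ZPeriodic f ∧
      ∀ x, |P x - (∫ t in (0 : ℝ)..1, P (x + t • fun i => (k i : ℝ))) -
        fderiv ℝ f x (fun i => (k i : ℝ))| < ε := by
  obtain ⟨G, hG⟩ := ZPeriodic.exists_lift (f := fun x => (P x : ℂ))
    (Complex.continuous_ofReal.comp hP) (fun k x => congrArg _ (hper k x))
  have hmem : G ∈ closure (Submodule.span ℂ (range (mFourier (d := Fin n))) : Set _) := by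
    rw [← Submodule.topologicalClosure_coe, span_mFourier_closure_eq_top]
    trivial
  obtain ⟨Q, hQ, hGQ⟩ := Metric.mem_closure_iff.1 hmem (ε / 2) (half_pos hε)
  obtain ⟨f, hf, hfp, hfd⟩ := exists_primitive_of_mem_span_mFourier k hQ
  have hbound : ∀ z, ‖G z - Q z‖ < ε / 2 := fun z => by
    rw [← dist_eq_norm]
    exact (ContinuousMap.dist_apply_le_dist z).trans_lt hGQ
  refine ⟨fun x => (f x).re, Complex.reCLM.contDiff.comp hf, fun k x => by simp only [hfp k x],
    fun x => ?_⟩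
  have hder : fderiv ℝ (fun x => (f x).re) x (fun i => (k i : ℝ)) =
      (fderiv ℝ f x (fun i => (k i : ℝ))).re := by
    have := (Complex.reCLM.hasFDerivAt.comp x (hf.differentiable (by simp) x).hasFDerivAt).fderiv
    exact congrArg (fun L => L (fun i => (k i : ℝ))) this
  have hint : ∀ R : C(UnitAddTorus (Fin n), ℂ), IntervalIntegrable
      (fun t : ℝ => R (torusMk (x + t • fun i => (k i : ℝ)))) volume 0 1 := fun R =>
    (R.continuous.comp (continuous_torusMk.comp (by fun_prop))).intervalIntegrable _ _
  have key : ((P x - (∫ t in (0 : ℝ)..1, P (x + t • fun i => (k i : ℝ))) : ℝ) : ℂ) -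
      fderiv ℝ f x (fun i => (k i : ℝ)) = (G (torusMk x) - Q (torusMk x)) -
      ∫ t in (0 : ℝ)..1, (G (torusMk (x + t • fun i => (k i : ℝ))) -
        Q (torusMk (x + t • fun i => (k i : ℝ)))) := by
    rw [intervalIntegral.integral_sub (hint G) (hint Q), ← hfd]
    simp only [hG]
    rw [intervalIntegral.integral_ofReal]
    push_cast
    ring
  have hI : ‖∫ t in (0 : ℝ)..1, (G (torusMk (x + t • fun i => (k i : ℝ))) -
        Q (torusMk (x + t • fun i => (k i : ℝ))))‖ ≤ ε / 2 := by
    simpa using intervalIntegral.norm_integral_le_of_norm_le_const (a := (0 : ℝ)) (b := 1)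
      (fun t _ => (hbound (torusMk (x + t • fun i => (k i : ℝ)))).le)
  rw [hder]
  calc _ = |(((P x - (∫ t in (0 : ℝ)..1, P (x + t • fun i => (k i : ℝ))) : ℝ) : ℂ) -
      fderiv ℝ f x (fun i => (k i : ℝ))).re| := by rw [Complex.sub_re, Complex.ofReal_re]
    _ ≤ _ := Complex.abs_re_le_norm _
    _ < ε := by
      rw [key]
      linarith [norm_sub_le (G (torusMk x) - Q (torusMk x))
        (∫ t in (0 : ℝ)..1, (G (torusMk (x + t • fun i => (k i : ℝ))) -
        Q (torusMk (x + t • fun i => (k i : ℝ))))), hbound (torusMk x)]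

lemma norm_mFourier_apply {n : ℕ} (m : Fin n → ℤ) (z : UnitAddTorus (Fin n)) :
    ‖mFourier m z‖ ≤ 1 :=
  (ContinuousMap.norm_coe_le_norm _ z).trans mFourier_norm.le

lemma integrable_of_continuous_torus {n : ℕ} {f : UnitAddTorus (Fin n) → ℂ} (hf : Continuous f) :
    Integrable f :=
  hf.integrable_of_hasCompactSupport (HasCompactSupport.of_compactSpace f)

lemma integral_mFourier_mul_eq_zero_of_line {n : ℕ} (P : C(UnitAddTorus (Fin n), ℂ))
    {m k : Fin n → ℤ} (hmk : ∑ i, m i * k i = 0)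
    (h : ∀ x, ∫ t in (0 : ℝ)..1, P (torusMk (x + t • fun i => (k i : ℝ))) = 0) :
    ∫ z, mFourier m z * P z = 0 := by
  have : IsFiniteMeasure ((volume : Measure ℝ).restrict (uIoc 0 1)) := ⟨by simp⟩
  have hm : ∀ (t : ℝ) z, mFourier m (z + torusMk (t • fun i => (k i : ℝ))) = mFourier m z := by
    intro t z
    obtain ⟨x, rfl⟩ := isOpenQuotientMap_torusMk.surjective z
    rw [← torusMk_add, mFourier_torusMk_add_smul, hmk]
    simp
  have hshift : ∀ t : ℝ, ∫ z, mFourier m z * P (z + torusMk (t • fun i => (k i : ℝ))) =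
      ∫ z, mFourier m z * P z := fun t => by
    rw [← integral_add_right_eq_self (fun z => mFourier m z * P z)
      (torusMk (t • fun i => (k i : ℝ)))]
    simp only [hm]
  calc ∫ z, mFourier m z * P z
      = ∫ t in (0 : ℝ)..1, ∫ z, mFourier m z * P (z + torusMk (t • fun i => (k i : ℝ))) := by
        simp only [hshift]
        simp
    _ = ∫ z, ∫ t in (0 : ℝ)..1, mFourier m z * P (z + torusMk (t • fun i => (k i : ℝ))) := by
        refine intervalIntegral_integral_swap (Integrable.of_bound (C := ‖P‖)
          (Continuous.aestronglyMeasurable ?_) (.of_forall fun q => ?_))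
        · refine ((mFourier m).continuous.comp continuous_snd).mul (P.continuous.comp ?_)
          exact continuous_snd.add (continuous_torusMk.comp (by fun_prop))
        · simp only [uncurry, norm_mul]
          exact (mul_le_mul (norm_mFourier_apply m _) (P.norm_coe_le_norm _) (norm_nonneg _)
            zero_le_one).trans (one_mul _).le
    _ = 0 := by
        refine (integral_congr_ae (.of_forall fun z => ?_)).trans (integral_zero _ _)
        obtain ⟨x, rfl⟩ := isOpenQuotientMap_torusMk.surjective z
        simp only [← torusMk_add]
        rw [intervalIntegral.integral_const_mul, h x, mul_zero]

lemma eq_zero_of_integral_mFourier_mul_eq_zero {n : ℕ} (W : C(UnitAddTorus (Fin n), ℂ))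
    (h : ∀ m, ∫ z, mFourier m z * W z = 0) : W = 0 := by
  let L : C(UnitAddTorus (Fin n), ℂ) →L[ℂ] ℂ := LinearMap.mkContinuous
    { toFun := fun Q => ∫ z, Q z * W z
      map_add' := fun Q R => by
        simp only [ContinuousMap.add_apply, add_mul]
        exact integral_add (integrable_of_continuous_torus (by fun_prop))
          (integrable_of_continuous_torus (by fun_prop))
      map_smul' := fun c Q => by
        simp only [ContinuousMap.smul_apply, smul_mul_assoc, RingHom.id_apply]
        exact integral_smul _ _ }
    (‖W‖ * volume.real (univ : Set (UnitAddTorus (Fin n)))) fun Q => by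
      refine (norm_integral_le_of_norm_le_const (C := ‖Q‖ * ‖W‖)
        (.of_forall fun z => ?_)).trans_eq (by ring)
      rw [norm_mul]
      exact mul_le_mul (Q.norm_coe_le_norm z) (W.norm_coe_le_norm z) (norm_nonneg _)
        (norm_nonneg _)
  have hle : Submodule.span ℂ (range mFourier) ≤ LinearMap.ker L.toLinearMap := by
    rw [Submodule.span_le]
    rintro _ ⟨m, rfl⟩
    exact h m
  have hle' := Submodule.topologicalClosure_minimal _ hle L.isClosed_ker
  rw [span_mFourier_closure_eq_top] at hle'
  have hW : ∫ z, star (W z) * W z = 0 := hle' (Submodule.mem_top (x := star W))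
  by_contra hne
  obtain ⟨z, hz⟩ := DFunLike.ne_iff.1 hne
  have hpos : 0 < ∫ z, ‖W z‖ ^ 2 :=
    Continuous.integral_pos_of_hasCompactSupport_nonneg_nonzero (x := z) (by fun_prop)
      (HasCompactSupport.of_compactSpace _) (fun z => by positivity)
      (pow_ne_zero 2 (norm_ne_zero_iff.2 hz))
  have hcast : ((∫ z, ‖W z‖ ^ 2 : ℝ) : ℂ) = ∫ z, star (W z) * W z := by
    rw [← integral_complex_ofReal]
    refine integral_congr_ae (.of_forall fun z => ?_)
    simpa using (Complex.conj_mul' (W z)).symm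
  rw [hW, Complex.ofReal_eq_zero] at hcast
  exact hpos.ne' hcast

section Smear

variable {n : ℕ} (R : C(UnitAddTorus (Fin n), ℂ)) {ψ : (Fin n → ℝ) → ℝ}

lemma continuous_integral_smul_torusMk (hψ : Continuous ψ) (hc : HasCompactSupport ψ) :
    Continuous fun z => ∫ x, ψ x • R (z + torusMk x) := by
  refine continuous_of_dominated (bound := fun x => ‖ψ x‖ * ‖R‖) (fun z => ?_)
    (fun z => .of_forall fun x => ?_) ?_ (.of_forall fun x => by fun_prop)
  · exact (hψ.smul (R.continuous.comp
      (continuous_const.add continuous_torusMk))).aestronglyMeasurable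
  · rw [norm_smul]
    exact mul_le_mul_of_nonneg_left (R.norm_coe_le_norm _) (norm_nonneg _)
  · exact (hψ.integrable_of_hasCompactSupport hc).norm.mul_const _

lemma integrable_smul_torusMk (hψ : Continuous ψ) (hc : HasCompactSupport ψ)
    (z : UnitAddTorus (Fin n)) : Integrable fun x => ψ x • R (z + torusMk x) :=
  (hψ.smul (R.continuous.comp
    (continuous_const.add continuous_torusMk))).integrable_of_hasCompactSupport hc.smul_right

lemma integral_mFourier_mul_integral_smul_torusMk (hψ : Continuous ψ) (hc : HasCompactSupport ψ)
    (m : Fin n → ℤ) :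
    ∫ z, mFourier m z * ∫ x, ψ x • R (z + torusMk x) =
      (∫ x, ψ x • mFourier (-m) (torusMk x)) * ∫ z, mFourier m z * R z := by
  have hinner : ∀ x : Fin n → ℝ, ∫ z, mFourier m z * R (z + torusMk x) =
      mFourier (-m) (torusMk x) * ∫ z, mFourier m z * R z := fun x => by
    rw [← integral_add_right_eq_self (fun z => mFourier m z * R z) (torusMk x),
      ← integral_const_mul]
    refine integral_congr_ae (.of_forall fun z => ?_)
    have h1 : mFourier (-m) (torusMk x) * mFourier m (torusMk x) = 1 := by
      rw [← mFourier_add, neg_add_cancel, mFourier_zero, ContinuousMap.one_apply]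
    simp only [mFourier_add_right]
    linear_combination (-mFourier m z * R (z + torusMk x)) * h1
  calc ∫ z, mFourier m z * ∫ x, ψ x • R (z + torusMk x)
      = ∫ z, ∫ x, mFourier m z * ψ x • R (z + torusMk x) := by
        simp only [integral_const_mul]
    _ = ∫ x, ∫ z, mFourier m z * ψ x • R (z + torusMk x) := by
        refine integral_integral_swap_of_hasCompactSupport ?_ ?_
        · refine ((mFourier m).continuous.comp continuous_fst).mul
            ((hψ.comp continuous_snd).smul (R.continuous.comp ?_))
          exact continuous_fst.add (continuous_torusMk.comp continuous_snd)
        · refine HasCompactSupport.intro (isCompact_univ.prod hc) fun q hq => ?_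
          have : ψ q.2 = 0 := by
            by_contra hne
            exact hq ⟨mem_univ _, subset_tsupport _ hne⟩
          simp [uncurry, this]
    _ = ∫ x, ψ x • mFourier (-m) (torusMk x) * ∫ z, mFourier m z * R z := by
        refine integral_congr_ae (.of_forall fun x => ?_)
        simp only [mul_smul_comm, smul_mul_assoc]
        rw [integral_smul, hinner]
    _ = _ := integral_mul_const _ _

end Smear

lemma integral_fderiv_smul_mFourier {n : ℕ} {φ : (Fin n → ℝ) → ℝ} (hφ : ContDiff ℝ (⊤ : ℕ∞) φ)
    (hc : HasCompactSupport φ) (m : Fin n → ℤ) (i : Fin n) :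
    ∫ x, fderiv ℝ φ x (Pi.single i 1) • mFourier (-m) (torusMk x) =
      2 * Real.pi * Complex.I * m i * ∫ x, φ x • mFourier (-m) (torusMk x) := by
  have hE := contDiff_mFourier_torusMk (-m)
  have hφ' : Continuous fun x => fderiv ℝ φ x (Pi.single i 1) :=
    (hφ.continuous_fderiv (by simp)).clm_apply continuous_const
  have hE' : Continuous fun x => fderiv ℝ (fun y => mFourier (-m) (torusMk y)) x (Pi.single i 1) :=
    (hE.continuous_fderiv (by simp)).clm_apply continuous_const
  have key := integral_smul_fderiv_eq_neg_fderiv_smul_of_integrable (μ := volume) (f := φ)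
    (g := fun y => mFourier (-m) (torusMk y)) (v := Pi.single i 1)
    ((hφ'.smul hE.continuous).integrable_of_hasCompactSupport (hc.fderiv_apply ℝ _).smul_right)
    ((hφ.continuous.smul hE').integrable_of_hasCompactSupport hc.smul_right)
    ((hφ.continuous.smul hE.continuous).integrable_of_hasCompactSupport hc.smul_right)
    (fun x _ => hφ.differentiable (by simp) x) (fun x _ => hE.differentiable (by simp) x)
  rw [eq_comm, neg_eq_iff_eq_neg] at key
  rw [key, ← integral_const_mul, ← integral_neg]
  refine integral_congr_ae (.of_forall fun x => ?_)
  simp only [fderiv_mFourier_torusMk]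
  simp [Pi.single_apply]
  ring

lemma isDistribClosed_of_line_integrals_eq_zero {n : ℕ} {p : (Fin n → ℝ) → (Fin n → ℝ)}
    (hp : Continuous p) (hper : ZPeriodic p)
    (h : ∀ i j, i ≠ j → ∀ a b : ℤ, IsCoprime a b → ∀ x, ∫ t in (0 : ℝ)..1,
      (a * p (x + t • fun l => ((Pi.single j a - Pi.single i b : Fin n → ℤ) l : ℝ)) j -
        b * p (x + t • fun l => ((Pi.single j a - Pi.single i b : Fin n → ℤ) l : ℝ)) i) = 0) :
    IsDistribClosed p := by
  intro φ hφ hc i j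
  rcases eq_or_ne i j with rfl | hij
  · simp
  have hlift : ∀ l, ∃ g : C(UnitAddTorus (Fin n), ℂ), ∀ x, g (torusMk x) = (p x l : ℂ) :=
    fun l => ZPeriodic.exists_lift (f := fun x => (p x l : ℂ))
      (Complex.continuous_ofReal.comp ((continuous_apply l).comp hp))
      fun k x => by simp only [hper k x]
  choose g hg using hlift
  have hcoeff : ∀ m : Fin n → ℤ, (m i : ℂ) * ∫ z, mFourier m z * g j z =
      m j * ∫ z, mFourier m z * g i z := by
    intro m
    obtain ⟨a, b, d, hab, ha, hb⟩ :
        ∃ a b d : ℤ, IsCoprime a b ∧ m i = a * d ∧ m j = b * d := by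
      rcases Nat.eq_zero_or_pos (Int.gcd (m i) (m j)) with h0 | h0
      · obtain ⟨h1, h2⟩ := Int.gcd_eq_zero_iff.1 h0
        exact ⟨1, 0, 0, isCoprime_one_left, by simp [h1], by simp [h2]⟩
      · obtain ⟨a, b, hab, ha, hb⟩ := Int.exists_gcd_one h0
        exact ⟨a, b, _, Int.isCoprime_iff_gcd_eq_one.2 hab, ha, hb⟩
    have hline := integral_mFourier_mul_eq_zero_of_line ((a : ℂ) • g j - (b : ℂ) • g i) (m := m)
      (k := Pi.single j a - Pi.single i b)
      (by
        simp [mul_sub, Finset.sum_sub_distrib, Pi.single_apply]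
        rw [ha, hb]
        ring)
      (fun x => by
        have hx := congrArg Complex.ofReal (h i j hij a b hab x)
        rw [← intervalIntegral.integral_ofReal, Complex.ofReal_zero] at hx
        simpa only [ContinuousMap.sub_apply, ContinuousMap.smul_apply, hg, smul_eq_mul,
          Complex.ofReal_sub, Complex.ofReal_mul, Complex.ofReal_intCast] using hx)
    have hsplit : ∫ z, mFourier m z * ((a : ℂ) • g j - (b : ℂ) • g i) z =
        a * (∫ z, mFourier m z * g j z) - b * ∫ z, mFourier m z * g i z := by
      rw [← integral_const_mul, ← integral_const_mul, ← integral_sub]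
      · refine integral_congr_ae (.of_forall fun z => ?_)
        simp
        ring
      · exact integrable_of_continuous_torus (by fun_prop)
      · exact integrable_of_continuous_torus (by fun_prop)
    rw [hsplit] at hline
    rw [ha, hb]
    push_cast
    linear_combination (d : ℂ) * hline
  have hd : ∀ l, Continuous fun x => fderiv ℝ φ x (Pi.single l 1) := fun l =>
    (hφ.continuous_fderiv (by simp)).clm_apply continuous_const
  have hdc : ∀ l : Fin n, HasCompactSupport fun x => fderiv ℝ φ x (Pi.single l 1) := fun l =>
    hc.fderiv_apply ℝ _
  let V : Fin n → Fin n → C(UnitAddTorus (Fin n), ℂ) := fun a b =>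
    ⟨fun z => ∫ x, fderiv ℝ φ x (Pi.single a 1) • g b (z + torusMk x),
      continuous_integral_smul_torusMk (g b) (hd a) (hdc a)⟩
  have hV : ∀ m a b, ∫ z, mFourier m z * V a b z = (2 * Real.pi * Complex.I * m a *
      ∫ x, φ x • mFourier (-m) (torusMk x)) * ∫ z, mFourier m z * g b z := fun m a b => by
    rw [← integral_fderiv_smul_mFourier hφ hc]
    exact integral_mFourier_mul_integral_smul_torusMk (g b) (hd a) (hdc a) m
  have hW : V i j - V j i = 0 := eq_zero_of_integral_mFourier_mul_eq_zero _ fun m => by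
    simp only [ContinuousMap.sub_apply, mul_sub]
    rw [integral_sub (integrable_of_continuous_torus (by fun_prop))
      (integrable_of_continuous_torus (by fun_prop)), hV, hV]
    linear_combination (2 * Real.pi * Complex.I *
      ∫ x, φ x • mFourier (-m) (torusMk x)) * hcoeff m
  have hW0 := DFunLike.congr_fun hW 0
  simp only [V, ContinuousMap.sub_apply, ContinuousMap.coe_mk, ContinuousMap.zero_apply] at hW0
  rw [← integral_sub (integrable_smul_torusMk _ (hd i) (hdc i) 0)
    (integrable_smul_torusMk _ (hd j) (hdc j) 0)] at hW0
  rw [← Complex.ofReal_eq_zero, ← hW0, ← integral_complex_ofReal]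
  refine integral_congr_ae (.of_forall fun x => ?_)
  simp only [zero_add, hg]
  simp
  ring

/-- A smooth function on the circle whose critical points are the solutions of
`cos (2 π t) = r`, when `|r| < 1`. -/
def sawtooth (r t : ℝ) : ℝ :=
  Real.sin (2 * Real.pi * t) / (1 - r * Real.cos (2 * Real.pi * t))

lemma one_sub_mul_cos_pos {r : ℝ} (hr : |r| < 1) (θ : ℝ) : 0 < 1 - r * Real.cos θ := by
  have h1 : |r * Real.cos θ| < 1 := by
    rw [abs_mul]
    exact (mul_le_of_le_one_right (abs_nonneg r) (Real.abs_cos_le_one θ)).trans_lt hr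
  linarith [le_abs_self (r * Real.cos θ)]

lemma contDiff_sawtooth {r : ℝ} (hr : |r| < 1) : ContDiff ℝ (⊤ : ℕ∞) (sawtooth r) :=
  ContDiff.div (by fun_prop) (by fun_prop) fun _ => (one_sub_mul_cos_pos hr _).ne'

lemma hasDerivAt_sawtooth {r : ℝ} (hr : |r| < 1) (t : ℝ) :
    HasDerivAt (sawtooth r) (2 * Real.pi * (Real.cos (2 * Real.pi * t) - r) /
      (1 - r * Real.cos (2 * Real.pi * t)) ^ 2) t := by
  have hlin : HasDerivAt (fun s : ℝ => 2 * Real.pi * s) (2 * Real.pi) t := by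
    simpa using (hasDerivAt_id t).const_mul (2 * Real.pi)
  have h := hlin.sin.div ((hlin.cos.const_mul r).const_sub 1) (one_sub_mul_cos_pos hr _).ne'
  refine h.congr_deriv ?_
  congr 1
  linear_combination (-2 * Real.pi * r) * Real.sin_sq_add_cos_sq (2 * Real.pi * t)

lemma cos_eq_of_deriv_sawtooth_eq_zero {r : ℝ} (hr : |r| < 1) {t : ℝ}
    (h : deriv (sawtooth r) t = 0) : Real.cos (2 * Real.pi * t) = r := by
  rw [(hasDerivAt_sawtooth hr t).deriv, div_eq_zero_iff] at h
  have h2 := (pow_pos (one_sub_mul_cos_pos hr (2 * Real.pi * t)) 2).ne'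
  have h3 : 2 * Real.pi ≠ 0 := Real.two_pi_pos.ne'
  simpa [h2, h3, sub_eq_zero, Real.pi_ne_zero] using h

lemma sawtooth_add_intCast (r t : ℝ) (k : ℤ) : sawtooth r (t + k) = sawtooth r t := by
  have h : 2 * Real.pi * (t + k) = 2 * Real.pi * t + k * (2 * Real.pi) := by ring
  rw [sawtooth, h, Real.sin_add_int_mul_two_pi, Real.cos_add_int_mul_two_pi, sawtooth]

lemma exists_int_add_of_cos_eq_cos {t δ : ℝ} (hδ : 0 ≤ δ)
    (h : Real.cos (2 * Real.pi * t) = Real.cos (2 * Real.pi * δ)) :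
    ∃ (N : ℤ) (ε : ℝ), |ε| ≤ δ ∧ t = N + ε := by
  have hpi : 2 * Real.pi ≠ 0 := Real.two_pi_pos.ne'
  obtain ⟨k, hk | hk⟩ := Real.cos_eq_cos_iff.1 h
  · refine ⟨-k, δ, (abs_of_nonneg hδ).le, mul_left_cancel₀ hpi ?_⟩
    push_cast
    linarith
  · refine ⟨k, -δ, by rw [abs_neg, abs_of_nonneg hδ], mul_left_cancel₀ hpi ?_⟩
    linarith

/-- The integer direction `a e_j - b e_i`, as a real vector. -/
def lineDir {n : ℕ} (i j : Fin n) (a b : ℤ) : Fin n → ℝ :=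
  fun l => ((Pi.single j a - Pi.single i b : Fin n → ℤ) l : ℝ)

lemma lineDir_eq {n : ℕ} (i j : Fin n) (a b : ℤ) :
    lineDir i j a b = (a : ℝ) • Pi.single j 1 - (b : ℝ) • Pi.single i 1 := by
  ext l
  simp [lineDir, Pi.single_apply]

lemma exists_smooth_critical_near_line {n : ℕ} {i j : Fin n} (hij : i ≠ j) {a b : ℤ}
    (hab : IsCoprime a b) (x₀ : Fin n → ℝ) {η : ℝ} (hη : 0 < η) :
    ∃ g : (Fin n → ℝ) → ℝ, ContDiff ℝ (⊤ : ℕ∞) g ∧ ZPeriodic g ∧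
      (∀ x, fderiv ℝ g x (lineDir i j a b) = 0) ∧
      ∀ x, (∀ l, fderiv ℝ g x (Pi.single l 1) = 0) →
        ∃ (s : ℝ) (N : Fin n → ℤ) (e : Fin n → ℝ), ‖e‖ < η ∧
          x = (x₀ + e + s • lineDir i j a b) + fun l => (N l : ℝ) := by
  obtain ⟨u, v, huv⟩ := hab
  have huv' : (u : ℝ) * a + v * b = 1 := by exact_mod_cast huv
  have hB : 0 < 1 + |(u : ℝ)| + |(v : ℝ)| := by positivity
  obtain ⟨δ, hδ0, hδ1, hδη⟩ : ∃ δ : ℝ, 0 < δ ∧ δ < 1 / 2 ∧ δ * (1 + |(u : ℝ)| + |(v : ℝ)|) < η := by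
    refine ⟨min (1 / 4) (η / 2 / (1 + |(u : ℝ)| + |(v : ℝ)|)), by positivity,
      (min_le_left _ _).trans_lt (by norm_num), ?_⟩
    have := mul_le_mul_of_nonneg_right (min_le_right (1 / 4) (η / 2 / (1 + |(u : ℝ)| + |(v : ℝ)|)))
      hB.le
    rw [div_mul_cancel₀ _ hB.ne'] at this
    linarith
  set r := Real.cos (2 * Real.pi * δ)
  have hr : |r| < 1 := by
    have hs : 0 < Real.sin (2 * Real.pi * δ) := Real.sin_pos_of_pos_of_lt_pi
      (by positivity) (by nlinarith [Real.pi_pos])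
    rw [← sq_lt_one_iff_abs_lt_one]
    nlinarith [Real.sin_sq_add_cos_sq (2 * Real.pi * δ)]
  have hsaw : ∀ t, HasDerivAt (sawtooth r) (deriv (sawtooth r) t) t := fun t =>
    (hasDerivAt_sawtooth hr t).differentiableAt.hasDerivAt
  let S : Finset (Fin n) := Finset.univ.filter fun l => l ≠ i ∧ l ≠ j
  let D : (Fin n → ℝ) → ℝ := fun x => a * (x i - x₀ i) + b * (x j - x₀ j)
  let g : (Fin n → ℝ) → ℝ := fun x => sawtooth r (D x) + ∑ l ∈ S, sawtooth r (x l - x₀ l)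
  have hproj : ∀ (l : Fin n) (x : Fin n → ℝ), HasFDerivAt (fun y : Fin n → ℝ => y l - x₀ l)
      (ContinuousLinearMap.proj (R := ℝ) (φ := fun _ : Fin n => ℝ) l) x := fun l x =>
    (hasFDerivAt_apply l x).sub_const _
  have hder : ∀ x w, fderiv ℝ g x w = deriv (sawtooth r) (D x) * (a * w i + b * w j) +
      ∑ l ∈ S, deriv (sawtooth r) (x l - x₀ l) * w l := by
    intro x w
    have h := ((hsaw (D x)).comp_hasFDerivAt x
      (((hproj i x).const_mul (a : ℝ)).add ((hproj j x).const_mul (b : ℝ)))).add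
      (HasFDerivAt.fun_sum fun l (_ : l ∈ S) => (hsaw (x l - x₀ l)).comp_hasFDerivAt x (hproj l x))
    have h' : HasFDerivAt g _ x := h
    rw [h'.fderiv]
    simp
    ring
  refine ⟨g, ?_, ?_, ?_, ?_⟩
  · exact ((contDiff_sawtooth hr).comp (by fun_prop)).add
      (ContDiff.sum fun l _ => (contDiff_sawtooth hr).comp (by fun_prop))
  · intro k x
    have hD : D (x + fun l => (k l : ℝ)) = D x + ((a * k i + b * k j : ℤ) : ℝ) := by
      simp only [D, Pi.add_apply]
      push_cast
      ring
    have hl : ∀ l, x l + (k l : ℝ) - x₀ l = x l - x₀ l + k l := fun l => by ring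
    simp only [g, hD, sawtooth_add_intCast, Pi.add_apply, hl]
  · intro x
    rw [hder, Finset.sum_eq_zero fun l hl => ?_]
    · simp [lineDir, hij, hij.symm]
      right
      ring
    · obtain ⟨-, hli, hlj⟩ := Finset.mem_filter.1 hl
      simp [lineDir, hli, hlj]
  · intro x hx
    have hcrit : ∀ t, deriv (sawtooth r) t = 0 → ∃ (N : ℤ) (ε : ℝ), |ε| ≤ δ ∧ t = N + ε :=
      fun t ht => exists_int_add_of_cos_eq_cos hδ0.le (cos_eq_of_deriv_sawtooth_eq_zero hr ht)
    have hDx : deriv (sawtooth r) (D x) = 0 := by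
      have hS : ∀ m, m = i ∨ m = j → ∑ l ∈ S, deriv (sawtooth r) (x l - x₀ l) *
          (Pi.single m 1 : Fin n → ℝ) l = 0 := fun m hm => Finset.sum_eq_zero fun l hl => by
        obtain ⟨-, hli, hlj⟩ := Finset.mem_filter.1 hl
        have : l ≠ m := by rcases hm with rfl | rfl <;> assumption
        simp [this]
      have hi := hx i
      have hj := hx j
      rw [hder, hS i (.inl rfl)] at hi
      rw [hder, hS j (.inr rfl)] at hj
      simp only [Pi.single_eq_same, Pi.single_eq_of_ne hij, Pi.single_eq_of_ne hij.symm] at hi hj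
      linear_combination (u : ℝ) * hi + (v : ℝ) * hj - deriv (sawtooth r) (D x) * huv'
    have hlx : ∀ l, l ≠ i ∧ l ≠ j → deriv (sawtooth r) (x l - x₀ l) = 0 := by
      intro l hl
      have h := hx l
      rw [hder, Finset.sum_eq_single_of_mem l (Finset.mem_filter.2 ⟨Finset.mem_univ _, hl⟩)
        fun m _ hm => by simp [hm]] at h
      simpa [hl.1.symm, hl.2.symm] using h
    obtain ⟨N₀, ε₀, hε₀, hN₀⟩ := hcrit _ hDx
    have hex : ∀ l, ∃ (N : ℤ) (ε : ℝ), l ≠ i ∧ l ≠ j → |ε| ≤ δ ∧ x l - x₀ l = N + ε := fun l => by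
      by_cases hl : l ≠ i ∧ l ≠ j
      · obtain ⟨N, ε, h⟩ := hcrit _ (hlx l hl)
        exact ⟨N, ε, fun _ => h⟩
      · exact ⟨0, 0, fun h => absurd h hl⟩
    choose M ε hMε using hex
    refine ⟨u * (x j - x₀ j) - v * (x i - x₀ i) - (u * (N₀ * v + ε₀ * v) - v * (N₀ * u + ε₀ * u)),
      fun l => if l = i then N₀ * u else if l = j then N₀ * v else M l,
      fun l => if l = i then ε₀ * u else if l = j then ε₀ * v else ε l, ?_, ?_⟩
    · refine lt_of_le_of_lt ((pi_norm_le_iff_of_nonneg (by positivity)).2 fun l => ?_) hδη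
      rw [Real.norm_eq_abs]
      split_ifs with h1 h2
      · rw [abs_mul]
        gcongr
        linarith [abs_nonneg (v : ℝ)]
      · rw [abs_mul]
        gcongr
        linarith [abs_nonneg (u : ℝ)]
      · refine (hMε l ⟨h1, h2⟩).1.trans (le_mul_of_one_le_right hδ0.le ?_)
        linarith [abs_nonneg (u : ℝ), abs_nonneg (v : ℝ)]
    · have hD : a * (x i - x₀ i) + b * (x j - x₀ j) = N₀ + ε₀ := hN₀
      ext l
      rcases eq_or_ne l i with rfl | h1
      · simp [lineDir, hij]
        linear_combination (-(x l - x₀ l)) * huv' + (u : ℝ) * hD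
      · rcases eq_or_ne l j with rfl | h2
        · simp [lineDir, hij.symm]
          linear_combination (-(x l - x₀ l)) * huv' + (v : ℝ) * hD
        · have := (hMε l ⟨h1, h2⟩).2
          simp [lineDir, h1, h2]
          linear_combination this

lemma ZPeriodic.fderiv {n : ℕ} {f : (Fin n → ℝ) → ℝ} (hf : ZPeriodic f) :
    ZPeriodic (fderiv ℝ f) := fun k x => by
  rw [← fderiv_comp_add_right]
  congr 1
  exact funext (hf k)

lemma exists_ne_smul_of_ne_zero_on_zeros {n : ℕ} {q G : (Fin n → ℝ) → (Fin n → ℝ)}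
    {Q : (Fin n → ℝ) → ℝ} (hq : Continuous q) (hG : Continuous G) (hQ : Continuous Q)
    (hqp : ZPeriodic q) (hGp : ZPeriodic G) (hQG : ∀ x (M : ℝ), q x = M • G x → Q x = 0)
    (hne : ∀ x, Q x = 0 → G x ≠ 0) : ∃ M : ℝ, ∀ x, q x ≠ M • G x := by
  have hK : IsCompact (Icc (0 : Fin n → ℝ) 1 ∩ {x | Q x = 0}) :=
    isCompact_Icc.inter_right (isClosed_eq hQ continuous_const)
  obtain ⟨C, hC⟩ := hK.exists_bound_of_continuousOn (f := fun x => ‖q x‖ / ‖G x‖)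
    (hq.norm.continuousOn.div hG.norm.continuousOn fun x hx => norm_ne_zero_iff.2 (hne x hx.2))
  refine ⟨|C| + 1, fun x hx => ?_⟩
  let y : Fin n → ℝ := x + fun l => ((-⌊x l⌋ : ℤ) : ℝ)
  have hy : q y = (|C| + 1) • G y := by
    rw [show q y = q x from hqp _ x, show G y = G x from hGp _ x, hx]
  have hyI : y ∈ Icc (0 : Fin n → ℝ) 1 := by
    constructor <;> intro l <;> simp [y]
    · exact Int.floor_le _
    · linarith [Int.lt_floor_add_one (x l)]
  have hQy := hQG y _ hy
  have hb := hC y ⟨hyI, hQy⟩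
  have hGy : ‖G y‖ ≠ 0 := norm_ne_zero_iff.2 (hne y hQy)
  rw [hy, norm_smul, mul_div_cancel_right₀ _ hGy, norm_norm, Real.norm_eq_abs,
    abs_of_pos (by positivity)] at hb
  linarith [le_abs_self C]

/-- If a continuous `ℤ^n`-periodic `p : ℝ^n → ℝ^n` (a continuous 1-form
on the torus `𝕋^n`, `n ≥ 1`) is not closed in the sense of distributions, then there is a
smooth `ℤ^n`-periodic function `f` such that `p(x) − ∇f(x)` never vanishes. -/
theorem nonclosed_form_shifted_off_zero
    (n : ℕ) (hn : 1 ≤ n) (p : (Fin n → ℝ) → (Fin n → ℝ))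
    (hp : Continuous p) (hper : ZPeriodic p)
    (hnotclosed : ¬ IsDistribClosed p) :
    ∃ f : (Fin n → ℝ) → ℝ, ContDiff ℝ (⊤ : ℕ∞) f ∧ ZPeriodic f ∧
      ∀ x, (fun i => p x i - fderiv ℝ f x (Pi.single i 1)) ≠ (0 : Fin n → ℝ) := by
  obtain ⟨i, j, hij, a, b, hab, x₀, hx₀⟩ : ∃ i j, i ≠ j ∧ ∃ a b : ℤ, IsCoprime a b ∧ ∃ x,
      ∫ t in (0 : ℝ)..1, (a * p (x + t • lineDir i j a b) j -
        b * p (x + t • lineDir i j a b) i) ≠ 0 := by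
    by_contra! h
    exact hnotclosed (isDistribClosed_of_line_integrals_eq_zero hp hper h)
  let P : (Fin n → ℝ) → ℝ := fun x => a * p x j - b * p x i
  have hP : Continuous P := by fun_prop
  have hPp : ZPeriodic P := fun k x => by simp only [P, hper k x]
  let F : (Fin n → ℝ) → ℝ := fun x => ∫ t in (0 : ℝ)..1, P (x + t • lineDir i j a b)
  have hF : Continuous F :=
    intervalIntegral.continuous_parametric_intervalIntegral_of_continuous' (by fun_prop) _ _
  have hc : 0 < |F x₀| / 2 := half_pos (abs_pos.2 hx₀)
  obtain ⟨η, hη, hηF⟩ := Metric.continuousAt_iff.1 (hF.continuousAt (x := x₀)) (|F x₀| / 2) hc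
  have hFline : ∀ x (s : ℝ), F (x + s • lineDir i j a b) = F x := by
    intro x s
    have hperiod : Function.Periodic (fun t : ℝ => P (x + t • lineDir i j a b)) 1 := fun t => by
      change P (x + (t + 1) • lineDir i j a b) = P (x + t • lineDir i j a b)
      rw [add_smul, one_smul, ← add_assoc]
      exact hPp (Pi.single j a - Pi.single i b) _
    have h1 := hperiod.intervalIntegral_add_eq s 0
    have h2 := intervalIntegral.integral_comp_add_right (a := 0) (b := 1)
      (fun t : ℝ => P (x + t • lineDir i j a b)) s
    rw [zero_add, add_comm 1 s, h1, zero_add] at h2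
    refine Eq.trans ?_ h2
    refine intervalIntegral.integral_congr fun t _ => ?_
    simp only [add_smul]
    congr 1
    abel
  have hFp : ZPeriodic F := fun k x => by
    refine intervalIntegral.integral_congr fun t _ => ?_
    simp only [add_right_comm x _ (t • lineDir i j a b)]
    exact hPp k _
  obtain ⟨f, hf, hfp, hfP⟩ := exists_smooth_primitive_approx hP hPp
    (Pi.single j a - Pi.single i b) hc
  obtain ⟨g, hg, hgp, hgline, hgcrit⟩ := exists_smooth_critical_near_line hij hab x₀ hη
  have hdir : ∀ L : (Fin n → ℝ) →L[ℝ] ℝ, L (lineDir i j a b) =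
      a * L (Pi.single j 1) - b * L (Pi.single i 1) := fun L => by
    rw [lineDir_eq, map_sub, map_smul, map_smul, smul_eq_mul, smul_eq_mul]
  have hgrad : ∀ {h : (Fin n → ℝ) → ℝ}, ContDiff ℝ (⊤ : ℕ∞) h →
      Continuous fun x (l : Fin n) => fderiv ℝ h x (Pi.single l 1) := fun hh =>
    continuous_pi fun l => (hh.continuous_fderiv (by simp)).clm_apply continuous_const
  have hgradp : ∀ {h : (Fin n → ℝ) → ℝ}, ZPeriodic h →
      ZPeriodic fun x (l : Fin n) => fderiv ℝ h x (Pi.single l 1) := fun hh k x => by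
    simp only [hh.fderiv k x]
  obtain ⟨M, hM⟩ := exists_ne_smul_of_ne_zero_on_zeros
    (q := fun x l => p x l - fderiv ℝ f x (Pi.single l 1))
    (G := fun x l => fderiv ℝ g x (Pi.single l 1))
    (Q := fun x => P x - fderiv ℝ f x (lineDir i j a b))
    (hp.sub (hgrad hf)) (hgrad hg)
    (hP.sub ((hf.continuous_fderiv (by simp)).clm_apply continuous_const))
    (fun k x => by simp only [hper k x, hfp.fderiv k x]) (hgradp hgp)
    (fun x M hx => by
      have hi := congrFun hx i
      have hj := congrFun hx j
      have hl := hgline x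
      rw [hdir] at hl ⊢
      simp only [Pi.smul_apply, smul_eq_mul] at hi hj
      simp only [P]
      linear_combination (a : ℝ) * hj - (b : ℝ) * hi + M * hl)
    (fun x hx hG => by
      obtain ⟨s, N, e, he, rfl⟩ := hgcrit x fun l => congrFun hG l
      have h1 := hfP ((x₀ + e + s • lineDir i j a b) + fun l => (N l : ℝ))
      change |P _ - F _ - fderiv ℝ f _ (lineDir i j a b)| < _ at h1
      rw [sub_right_comm, hx, hFp, hFline, zero_sub, abs_neg] at h1
      have h2 := hηF (x := x₀ + e) (by simpa using he)
      rw [Real.dist_eq, abs_sub_comm] at h2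
      linarith [abs_sub_abs_le_abs_sub (F x₀) (F (x₀ + e))])
  refine ⟨f + fun x => M * g x, hf.add (contDiff_const.mul hg),
    fun k x => by simp only [Pi.add_apply, hfp k x, hgp k x], fun x hx => hM x ?_⟩
  funext l
  have hl := congrFun hx l
  rw [fderiv_add (hf.differentiable (by simp) x)
    ((hg.differentiable (by simp) x).const_mul M), add_apply,
    fderiv_const_mul (hg.differentiable (by simp) x), smul_apply] at hl
  simp only [Pi.zero_apply, smul_eq_mul] at hl
  simp only [Pi.smul_apply, smul_eq_mul]
  linarith
end
end

section
/- Let m ≥ 0 and let p : ℝ^{1+m} → ℝ^{1+m} be a continuous ℤ^{1+m}-periodic map, viewed as a continuous 1-form on the torus 𝕋^{1+m}, whose coordinates are written (θ, y) with θ ∈ ℝ and y ∈ ℝ^m. Let e_1 = (1, 0, …, 0). Assume there exists δ > 0 such that for every C^1 curve γ : ℝ → ℝ^{1+m} satisfying γ(t+1) = γ(t) + e_1 for all t, and such that for some y ∈ ℝ^m one has sup_t ‖γ(t) − (t, y)‖ + sup_t ‖γ'(t) − e_1‖ < δ (i.e. γ is a loop C^1-close to a fiber of the circle fibration), the line integral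 ∫_0^1 ⟨p(γ(t)), γ'(t)⟩ dt vanishes. Then p is closed in the sense of distributions. -/
open Set Function MeasureTheory

noncomputable section

open Topology Convolution Interval

section OneForms

variable {E : Type*} [NormedAddCommGroup E] [NormedSpace ℝ E]

/-- The line integral of the 1-form `P` vanishes along every `C^1` loop in the class `e` that is
`δ`-close in `C^1` to a straight loop `t ↦ x + t • e`, where `x` is arbitrary. -/
def VanishesOnLoopsNear (e : E) (δ : ℝ) (P : E → E →L[ℝ] ℝ) : Prop :=
  ∀ γ : ℝ → E, ContDiff ℝ 1 γ → (∀ t, γ (t + 1) = γ t + e) →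
    ∀ (x : E) (C₁ C₂ : ℝ), C₁ + C₂ < δ → (∀ t, ‖γ t - (x + t • e)‖ ≤ C₁) →
      (∀ t, ‖deriv γ t - e‖ ≤ C₂) → ∫ t in (0 : ℝ)..1, P (γ t) (deriv γ t) = 0

theorem hasDerivAt_intervalIntegral_of_continuous {F F' : ℝ → ℝ → ℝ} {a b s₀ : ℝ}
    (hF : Continuous (uncurry F)) (hF' : Continuous (uncurry F'))
    (h : ∀ s t, HasDerivAt (fun r => F r t) (F' s t) s) :
    HasDerivAt (fun s => ∫ t in a..b, F s t) (∫ t in a..b, F' s₀ t) s₀ := by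
  have hc : ∀ s, Continuous (F s) := fun s => hF.comp (by fun_prop : Continuous fun t => (s, t))
  have hc' : Continuous (F' s₀) := hF'.comp (by fun_prop : Continuous fun t => (s₀, t))
  obtain ⟨C, hC⟩ := ((isCompact_closedBall s₀ 1).prod (isCompact_uIcc (a := a) (b := b))
    ).exists_bound_of_continuousOn hF'.continuousOn
  refine (intervalIntegral.hasDerivAt_integral_of_dominated_loc_of_deriv_le
    (bound := fun _ => C) (Metric.closedBall_mem_nhds s₀ one_pos)
    (Filter.Eventually.of_forall fun s => (hc s).aestronglyMeasurable)
    ((hc s₀).intervalIntegrable a b) hc'.aestronglyMeasurable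
    (Filter.Eventually.of_forall fun t ht s hs => hC (s, t) ⟨hs, uIoc_subset_uIcc ht⟩)
    intervalIntegrable_const (Filter.Eventually.of_forall fun t _ s _ => h s t)).2

/-- First variation of the line integral of a `C^1` form along a loop, in integrated form. -/
theorem integral_exteriorDeriv_eq_zero {P : E → E →L[ℝ] ℝ} (hP : ContDiff ℝ 1 P) {α η : ℝ → E}
    (hα : ContDiff ℝ 1 α) (hη : ContDiff ℝ 1 η) (hη1 : η 1 = η 0) (hPα : P (α 1) = P (α 0))
    (h : ∀ᶠ s : ℝ in 𝓝 0,
      ∫ t in (0 : ℝ)..1, P (α t + s • η t) (deriv α t + s • deriv η t) = 0) :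
    ∫ t in (0 : ℝ)..1,
      (fderiv ℝ P (α t) (η t) (deriv α t) - fderiv ℝ P (α t) (deriv α t) (η t)) = 0 := by
  have cα := hα.continuous
  have cη := hη.continuous
  have cα' := hα.continuous_deriv le_rfl
  have cη' := hη.continuous_deriv le_rfl
  have cP := hP.continuous
  have cP' := hP.continuous_fderiv one_ne_zero
  have hPd : ∀ x, HasFDerivAt P (fderiv ℝ P x) x := fun x =>
    (hP.differentiable one_ne_zero x).hasFDerivAt
  have hαd : ∀ t, HasDerivAt α (deriv α t) t := fun t =>
    (hα.differentiable one_ne_zero t).hasDerivAt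
  have hηd : ∀ t, HasDerivAt η (deriv η t) t := fun t =>
    (hη.differentiable one_ne_zero t).hasDerivAt
  have hvar := hasDerivAt_intervalIntegral_of_continuous (a := 0) (b := 1) (s₀ := 0)
    (F := fun s t => P (α t + s • η t) (deriv α t + s • deriv η t))
    (F' := fun s t => fderiv ℝ P (α t + s • η t) (η t) (deriv α t + s • deriv η t)
      + P (α t + s • η t) (deriv η t))
    (by unfold uncurry; fun_prop) (by unfold uncurry; fun_prop) (fun s t => by
      have h1 : HasDerivAt (fun r : ℝ => α t + r • η t) (η t) s := by
        simpa using ((hasDerivAt_id s).smul_const (η t)).const_add (α t)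
      have h2 : HasDerivAt (fun r : ℝ => deriv α t + r • deriv η t) (deriv η t) s := by
        simpa using ((hasDerivAt_id s).smul_const (deriv η t)).const_add (deriv α t)
      exact ((hPd _).comp_hasDerivAt s h1).clm_apply h2)
  have h0 := hvar.unique ((hasDerivAt_const (0 : ℝ) (0 : ℝ)).congr_of_eventuallyEq h)
  have hftc : ∫ t in (0 : ℝ)..1,
      (fderiv ℝ P (α t) (deriv α t) (η t) + P (α t) (deriv η t)) = 0 := by
    have hd : ∀ t, HasDerivAt (fun t => P (α t) (η t))
        (fderiv ℝ P (α t) (deriv α t) (η t) + P (α t) (deriv η t)) t := fun t =>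
      ((hPd _).comp_hasDerivAt t (hαd t)).clm_apply (hηd t)
    rw [intervalIntegral.integral_eq_sub_of_hasDerivAt (fun t _ => hd t)
      (Continuous.intervalIntegrable (by fun_prop) _ _), hη1, hPα, sub_self]
  simp only [zero_smul, add_zero] at h0
  have hsub := intervalIntegral.integral_sub (μ := volume) (a := 0) (b := 1)
    (f := fun t => fderiv ℝ P (α t) (η t) (deriv α t) + P (α t) (deriv η t))
    (g := fun t => fderiv ℝ P (α t) (deriv α t) (η t) + P (α t) (deriv η t))
    (Continuous.intervalIntegrable (by fun_prop) _ _)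
    (Continuous.intervalIntegrable (by fun_prop) _ _)
  rw [h0, hftc, sub_zero] at hsub
  simpa only [add_sub_add_right_eq_sub] using hsub

theorem Function.Periodic.exists_norm_le {F : Type*} [NormedAddCommGroup F] {f : ℝ → F} {c : ℝ}
    (hf : Periodic f c) (hc : c ≠ 0) (hcont : Continuous f) : ∃ C, ∀ t, ‖f t‖ ≤ C := by
  obtain ⟨C, hC⟩ := (hf.isBounded_of_continuous hc hcont).exists_norm_le
  exact ⟨C, fun t => hC _ ⟨t, rfl⟩⟩

theorem Function.Periodic.periodic_deriv {F : Type*} [NormedAddCommGroup F] [NormedSpace ℝ F]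
    {f : ℝ → F} {c : ℝ} (hf : Periodic f c) : Periodic (deriv f) c := fun t => by
  rw [← deriv_comp_add_const f c t]
  exact congrArg (fun g => deriv g t) (funext hf)

theorem VanishesOnLoopsNear.fderiv_symm_along {e : E} {δ : ℝ} {P : E → E →L[ℝ] ℝ}
    (hv : VanishesOnLoopsNear e δ P) (hP : ContDiff ℝ 2 P) (hper : ∀ x, P (x + e) = P x)
    {α : ℝ → E} (hα : ContDiff ℝ 2 α) (hα1 : ∀ t, α (t + 1) = α t + e) {x : E} {C₁ C₂ : ℝ}
    (hC : C₁ + C₂ < δ) (hC₁ : ∀ t, ‖α t - (x + t • e)‖ ≤ C₁) (hC₂ : ∀ t, ‖deriv α t - e‖ ≤ C₂)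
    (w : E) : fderiv ℝ P (α 0) w (deriv α 0) = fderiv ℝ P (α 0) (deriv α 0) w := by
  set h : ℝ → ℝ := fun t => fderiv ℝ P (α t) w (deriv α t) - fderiv ℝ P (α t) (deriv α t) w
    with hdef
  have hα' : ContDiff ℝ 1 (deriv α) := hα.deriv'
  have hα1' : ContDiff ℝ 1 α := hα.of_le one_le_two
  have hP' : ContDiff ℝ 1 (fderiv ℝ P) := hP.fderiv_right le_rfl
  have hh : ContDiff ℝ 1 h := by
    have := hP'.comp hα1'
    exact ((this.clm_apply contDiff_const).clm_apply hα').sub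
      ((this.clm_apply hα').clm_apply contDiff_const)
  have hPfper : ∀ y, fderiv ℝ P (y + e) = fderiv ℝ P y := fun y => by
    rw [← fderiv_comp_add_right]
    exact congrArg (fun g => fderiv ℝ g y) (funext hper)
  have hα'per : ∀ t, deriv α (t + 1) = deriv α t := fun t => by
    rw [← deriv_comp_add_const, funext hα1, deriv_add_const]
  have hhper : Periodic h 1 := fun t => by simp only [hdef, hα1, hPfper, hα'per]
  have hηd : ∀ t, HasDerivAt (fun t => h t • w) (deriv h t • w) t := fun t =>
    (hh.differentiable one_ne_zero t).hasDerivAt.smul_const w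
  obtain ⟨B₁, hB₁⟩ := hhper.exists_norm_le one_ne_zero hh.continuous
  obtain ⟨B₂, hB₂⟩ := hhper.periodic_deriv.exists_norm_le one_ne_zero
    (hh.continuous_deriv le_rfl)
  have hsmall : ∀ᶠ s : ℝ in 𝓝 0, (C₁ + |s| * (B₁ * ‖w‖)) + (C₂ + |s| * (B₂ * ‖w‖)) < δ := by
    have : Continuous fun s : ℝ => (C₁ + |s| * (B₁ * ‖w‖)) + (C₂ + |s| * (B₂ * ‖w‖)) := by
      fun_prop
    exact this.continuousAt.eventually_lt continuousAt_const (by simpa using hC)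
  have key := integral_exteriorDeriv_eq_zero (hP.of_le one_le_two) hα1'
    (η := fun t => h t • w) (hh.smul contDiff_const) (by simpa using congrArg (· • w) (hhper 0))
    (by rw [← hper (α 0), ← hα1, zero_add]) (by
      filter_upwards [hsmall] with s hs
      have hd : ∀ t, HasDerivAt (fun t => α t + s • h t • w)
          (deriv α t + s • deriv h t • w) t := fun t =>
        (hα1'.differentiable one_ne_zero t).hasDerivAt.add ((hηd t).const_smul s)
      have := hv (fun t => α t + s • h t • w)
        (hα1'.add (contDiff_const.smul (hh.smul contDiff_const)))
        (fun t => by rw [hα1, hhper t]; abel) x _ _ hs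
        (fun t => by
          rw [add_sub_right_comm]
          refine (norm_add_le _ _).trans (add_le_add (hC₁ t) ?_)
          rw [norm_smul, norm_smul, Real.norm_eq_abs]
          gcongr
          exact hB₁ t)
        (fun t => by
          rw [(hd t).deriv, add_sub_right_comm]
          refine (norm_add_le _ _).trans (add_le_add (hC₂ t) ?_)
          rw [norm_smul, norm_smul, Real.norm_eq_abs]
          gcongr
          exact hB₂ t)
      simpa only [(hd _).deriv, (hηd _).deriv] using this)
  have hsq : ∫ t in (0 : ℝ)..1, h t * h t = 0 := by
    rw [← key]
    congr 1
    ext t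
    simp only [hdef, map_smul, smul_apply, smul_eq_mul]
    ring
  by_contra hne
  have hpos : 0 < ∫ t in (0 : ℝ)..1, h t * h t :=
    intervalIntegral.integral_pos one_pos (hh.continuous.mul hh.continuous).continuousOn
      (fun t _ => mul_self_nonneg _)
      ⟨0, left_mem_Icc.2 zero_le_one, mul_self_pos.2 (sub_ne_zero.2 hne)⟩
  exact hpos.ne' hsq

/-- A `C^2` form that vanishes on all loops near straight loops is closed. -/
theorem VanishesOnLoopsNear.fderiv_symm {e : E} {δ : ℝ} {P : E → E →L[ℝ] ℝ} (hδ : 0 < δ)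
    (hv : VanishesOnLoopsNear e δ P) (hP : ContDiff ℝ 2 P) (hper : ∀ x, P (x + e) = P x)
    (x u w : E) : fderiv ℝ P x w u = fderiv ℝ P x u w := by
  have key : ∀ u : E, 2 * ‖u‖ < δ →
      fderiv ℝ P x w (e + u) = fderiv ℝ P x (e + u) w := fun u hu => by
    set c : ℝ := (2 * Real.pi)⁻¹ with hc
    have hc0 : 0 ≤ c := by positivity
    have hc1 : c ≤ 1 := inv_le_one_of_one_le₀ (by linarith [Real.pi_gt_three])
    have hd : ∀ t, HasDerivAt (fun t : ℝ => x + t • e + (c * Real.sin (2 * Real.pi * t)) • u)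
        (e + Real.cos (2 * Real.pi * t) • u) t := fun t => by
      have h1 : HasDerivAt (fun t : ℝ => x + t • e) e t := by
        simpa using ((hasDerivAt_id t).smul_const e).const_add x
      have h2 : HasDerivAt (fun t => c * Real.sin (2 * Real.pi * t))
          (c * (Real.cos (2 * Real.pi * t) * (2 * Real.pi * 1))) t :=
        (((hasDerivAt_id t).const_mul (2 * Real.pi)).sin).const_mul c
      have h3 := h1.add (h2.smul_const u)
      rwa [show c * (Real.cos (2 * Real.pi * t) * (2 * Real.pi * 1)) =
        Real.cos (2 * Real.pi * t) by
        rw [hc]; field_simp] at h3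
    have := hv.fderiv_symm_along hP hper
      (α := fun t : ℝ => x + t • e + (c * Real.sin (2 * Real.pi * t)) • u) (by fun_prop)
      (fun t => by
        rw [mul_add, mul_one, Real.sin_add_two_pi, add_smul, one_smul]
        abel) (x := x) (C₁ := ‖u‖) (C₂ := ‖u‖) (by linarith)
      (fun t => by
        rw [add_sub_cancel_left, norm_smul, norm_mul, Real.norm_of_nonneg hc0]
        exact mul_le_of_le_one_left (norm_nonneg _)
          (mul_le_one₀ hc1 (norm_nonneg _) (Real.abs_sin_le_one _)))
      (fun t => by
        rw [(hd t).deriv, add_sub_cancel_left, norm_smul]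
        exact mul_le_of_le_one_left (norm_nonneg _) (Real.abs_cos_le_one _)) w
    simpa [(hd 0).deriv] using this
  set ε : ℝ := δ / (4 * (‖u‖ + 1)) with hε
  have hε0 : 0 < ε := by positivity
  have h0 := key 0 (by simpa using hδ)
  have h1 := key (ε • u) (by
    rw [norm_smul, Real.norm_of_nonneg hε0.le, hε, div_mul_eq_mul_div,
      mul_div_assoc', div_lt_iff₀ (by positivity)]
    nlinarith [norm_nonneg u])
  simp only [add_zero, map_add, map_smul, add_apply, smul_apply, smul_eq_mul] at h0 h1
  rw [h0, add_right_inj] at h1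
  exact mul_left_cancel₀ hε0.ne' h1

end OneForms

section Mollification

variable {E : Type*} [NormedAddCommGroup E] [NormedSpace ℝ E] [FiniteDimensional ℝ E]
  [MeasurableSpace E] [BorelSpace E] {μ : Measure E} [μ.IsAddHaarMeasure]

theorem convolution_flip_lsmul_apply {q : E → E →L[ℝ] ℝ} (hq : Continuous q) {ψ : E → ℝ}
    (hψ : Continuous ψ) (hcψ : HasCompactSupport ψ) (w v : E) :
    (q ⋆[(ContinuousLinearMap.lsmul ℝ ℝ).flip, μ] ψ) w v = ∫ x, ψ x * q (w - x) v ∂μ := by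
  rw [convolution_eq_swap]
  simp only [ContinuousLinearMap.flip_apply, ContinuousLinearMap.lsmul_apply]
  rw [ContinuousLinearMap.integral_apply]
  · simp
  · exact (hψ.smul (hq.comp (by fun_prop))).integrable_of_hasCompactSupport hcψ.smul_right

theorem VanishesOnLoopsNear.convolution {e : E} {δ : ℝ} {q : E → E →L[ℝ] ℝ}
    (hv : VanishesOnLoopsNear e δ q) (hq : Continuous q) {ψ : E → ℝ}
    (hψ : Continuous ψ) (hcψ : HasCompactSupport ψ) :
    VanishesOnLoopsNear e δ (q ⋆[(ContinuousLinearMap.lsmul ℝ ℝ).flip, μ] ψ) := by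
  intro γ hγ hγ1 x C₁ C₂ hC hC₁ hC₂
  simp only [convolution_flip_lsmul_apply hq hψ hcψ]
  have cγ := hγ.continuous
  have cγ' := hγ.continuous_deriv le_rfl
  have hint : Integrable (uncurry fun t z => ψ z * q (γ t - z) (deriv γ t))
      ((volume.restrict (Ι (0 : ℝ) 1)).prod μ) := by
    have hcont : Continuous (uncurry fun t z => ψ z * q (γ t - z) (deriv γ t)) := by
      unfold uncurry
      fun_prop
    have h1 : IntegrableOn (uncurry fun t z => ψ z * q (γ t - z) (deriv γ t))
        (uIcc (0 : ℝ) 1 ×ˢ tsupport ψ) (volume.prod μ) :=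
      hcont.continuousOn.integrableOn_compact (isCompact_uIcc.prod hcψ)
    have h2 : IntegrableOn (uncurry fun t z => ψ z * q (γ t - z) (deriv γ t))
        (Ι (0 : ℝ) 1 ×ˢ univ) (volume.prod μ) :=
      h1.of_forall_sdiff_eq_zero (measurableSet_uIoc.prod MeasurableSet.univ) (by
        rintro ⟨t, z⟩ ⟨⟨ht, -⟩, hn⟩
        have : z ∉ tsupport ψ := fun hz => hn ⟨uIoc_subset_uIcc ht, hz⟩
        simp [uncurry, image_eq_zero_of_notMem_tsupport this])
    rwa [IntegrableOn, ← Measure.prod_restrict, Measure.restrict_univ] at h2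
  rw [intervalIntegral_integral_swap hint]
  refine integral_eq_zero_of_ae (Filter.Eventually.of_forall fun z => ?_)
  have hz := hv (fun t => γ t - z) (hγ.sub contDiff_const)
    (fun t => by rw [hγ1]; abel) (x - z) C₁ C₂ hC
    (fun t => by convert hC₁ t using 2; abel)
    (fun t => by rw [deriv_sub_const]; exact hC₂ t)
  simp only [deriv_sub_const] at hz
  simp [intervalIntegral.integral_const_mul, hz]

/-- A continuous `e`-periodic form that vanishes on all loops near straight loops is closed in
the sense of distributions. -/
theorem VanishesOnLoopsNear.integral_fderiv_symm {e : E} {δ : ℝ} {q : E → E →L[ℝ] ℝ} (hδ : 0 < δ)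
    (hv : VanishesOnLoopsNear e δ q) (hq : Continuous q) (hper : ∀ x, q (x + e) = q x)
    {φ : E → ℝ} (hφ : ContDiff ℝ 2 φ) (hcφ : HasCompactSupport φ) (u w : E) :
    ∫ x, q x w * fderiv ℝ φ x u ∂μ = ∫ x, q x u * fderiv ℝ φ x w ∂μ := by
  set ψ : E → ℝ := fun x => φ (-x) with hψdef
  have hψ : ContDiff ℝ 2 ψ := hφ.comp contDiff_neg
  have hcψ : HasCompactSupport ψ := hcφ.comp_homeomorph (Homeomorph.neg E)
  have hqint := hq.locallyIntegrable (μ := μ)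
  set P := q ⋆[(ContinuousLinearMap.lsmul ℝ ℝ).flip, μ] ψ with hPdef
  have hP : ContDiff ℝ 2 P := hcψ.contDiff_convolution_right (n := 2) _ hqint hψ
  have hPper : ∀ x, P (x + e) = P x := fun x => by
    ext v
    simp only [hPdef, convolution_flip_lsmul_apply hq hψ.continuous hcψ]
    simp only [add_sub_right_comm, hper]
  have hfd : ∀ u w, fderiv ℝ P 0 u w = -∫ x, q x w * fderiv ℝ φ x u ∂μ := fun u w => by
    have hψ' : ∀ x, fderiv ℝ ψ (-x) = -fderiv ℝ φ x := fun x => by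
      have h1 : HasFDerivAt φ (fderiv ℝ φ x) (-(-x)) := by
        rw [neg_neg]
        exact (hφ.differentiable two_ne_zero x).hasFDerivAt
      simpa [hψdef, Function.comp_def] using (h1.comp (-x) (hasFDerivAt_id (-x)).neg).fderiv
    have cψ' := hψ.continuous_fderiv two_ne_zero
    rw [(hcψ.hasFDerivAt_convolution_right _ hqint (hψ.of_le one_le_two) 0).fderiv,
      convolution_precompR_apply _ hqint (hcψ.fderiv (𝕜 := ℝ)) cψ',
      convolution_flip_lsmul_apply hq (by fun_prop) (hcψ.fderiv_apply (𝕜 := ℝ) u),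
      ← integral_neg_eq_self, ← integral_neg]
    congr 1
    ext x
    simp [hψ', mul_comm]
  have := (hv.convolution hq hψ.continuous hcψ (μ := μ)).fderiv_symm hδ hP hPper 0 u w
  rw [← neg_inj, ← hfd, ← hfd]
  exact this.symm

end Mollification

/-- The constant-coefficient 1-form `Σ_i a_i dx_i`. -/
def dotForm (n : ℕ) : (Fin n → ℝ) →L[ℝ] (Fin n → ℝ) →L[ℝ] ℝ :=
  ∑ i, (ContinuousLinearMap.mul ℝ ℝ).bilinearComp
    (ContinuousLinearMap.proj i) (ContinuousLinearMap.proj i)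

theorem dotForm_apply {n : ℕ} (a v : Fin n → ℝ) : dotForm n a v = ∑ i, a i * v i := by
  simp [dotForm]

theorem ZPeriodic.add_single {n : ℕ} {α : Type*} {f : (Fin n → ℝ) → α} (hf : ZPeriodic f)
    (i : Fin n) (x : Fin n → ℝ) : f (x + Pi.single i 1) = f x := by
  rw [← hf (Pi.single i 1) x]
  congr 2
  ext j
  obtain rfl | h := eq_or_ne j i <;> simp [*]

/-- Let `p : ℝ^{1+m} → ℝ^{1+m}` be a continuous `ℤ^{1+m}`-periodic
1-form on `𝕋^{1+m}`; coordinates are `(θ, y)` with `θ` the coordinate `0` and `e₁` the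
corresponding unit vector. If there is `δ > 0` such that the line integral
`∫_0^1 ⟨p(γ(t)), γ'(t)⟩ dt` vanishes for every `C^1` loop `γ` with
`γ(t+1) = γ(t) + e₁` which is `δ`-close (in `C^1`, i.e. sup-distance to a fiber
`t ↦ (t,y)` plus sup-distance of `γ'` to `e₁` is `< δ`) to a fiber of the circle
fibration `𝕋^{1+m} → 𝕋^m`, then `p` is closed in the sense of distributions. -/
theorem closed_iff_vanishing_on_loops_near_fibers
    (m : ℕ) (p : (Fin (m + 1) → ℝ) → (Fin (m + 1) → ℝ))
    (hp : Continuous p) (hper : ZPeriodic p)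
    (δ : ℝ) (hδ : 0 < δ)
    (hloop : ∀ γ : ℝ → (Fin (m + 1) → ℝ), ContDiff ℝ 1 γ →
      (∀ t, γ (t + 1) = γ t + (Pi.single 0 1 : Fin (m + 1) → ℝ)) →
      (∃ (v : Fin (m + 1) → ℝ) (C₁ C₂ : ℝ), v 0 = 0 ∧ C₁ + C₂ < δ ∧
        (∀ t, ‖γ t - (v + t • (Pi.single 0 1 : Fin (m + 1) → ℝ))‖ ≤ C₁) ∧
        (∀ t, ‖deriv γ t - (Pi.single 0 1 : Fin (m + 1) → ℝ)‖ ≤ C₂)) →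
      (∫ t in (0:ℝ)..1, ∑ i, p (γ t) i * deriv γ t i) = 0) :
    IsDistribClosed p := by
  set e : Fin (m + 1) → ℝ := Pi.single 0 1 with he
  have hpe : ∀ x, p (x + e) = p x := hper.add_single 0
  have hv : VanishesOnLoopsNear e δ (fun x => dotForm (m + 1) (p x)) := by
    intro γ hγ hγ1 x C₁ C₂ hC hC₁ hC₂
    have hper1 : Periodic (fun t => dotForm (m + 1) (p (γ t)) (deriv γ t)) 1 := fun t => by
      have hd : deriv γ (t + 1) = deriv γ t := by
        rw [← deriv_comp_add_const, funext hγ1, deriv_add_const]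
      simp only [hγ1, hpe, hd]
    have := hloop (fun t => γ (t - x 0)) (hγ.comp (contDiff_id.sub contDiff_const))
      (fun t => by rw [add_sub_right_comm, hγ1])
      ⟨x - x 0 • e, C₁, C₂, by simp [he], hC,
        fun t => by
          have h1 := hC₁ (t - x 0)
          rwa [sub_smul, ← add_sub_assoc, ← sub_add_eq_add_sub] at h1,
        fun t => by rw [deriv_comp_sub_const]; exact hC₂ _⟩
    simp only [deriv_comp_sub_const, ← dotForm_apply] at this
    rw [intervalIntegral.integral_comp_sub_right
      (fun t => dotForm (m + 1) (p (γ t)) (deriv γ t)) (x 0), zero_sub, sub_eq_neg_add,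
      hper1.intervalIntegral_add_eq (-x 0) 0] at this
    simpa using this
  intro φ hφ hcφ i j
  have hq : Continuous fun x => dotForm (m + 1) (p x) := by fun_prop
  have hsymm := hv.integral_fderiv_symm (μ := volume) hδ hq (fun x => by rw [hpe])
    (contDiff_infty.1 hφ 2) hcφ (Pi.single i 1) (Pi.single j 1)
  have hsingle : ∀ (a : Fin (m + 1) → ℝ) (k), dotForm (m + 1) a (Pi.single k 1) = a k :=
    fun a k => by simp [dotForm_apply, Pi.single_apply]
  simp only [hsingle] at hsymm
  have hint : ∀ k l : Fin (m + 1),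
      Integrable (fun x => p x k * fderiv ℝ φ x (Pi.single l 1)) := fun k l => by
    have cφ' := hφ.continuous_fderiv (by simp)
    exact Continuous.integrable_of_hasCompactSupport (by fun_prop)
      (hcφ.fderiv_apply (𝕜 := ℝ) _).mul_left
  rw [integral_sub (hint j i) (hint i j), hsymm, sub_self]
end
end

section
/- Let m ≥ 1, let α = (α_θ, α_y) : ℝ × ℝ^m → ℝ × ℝ^m be a continuous ℤ^{1+m}-periodic map (a continuous 1-form α_θ dθ + Σ_i α_{y,i} dy_i on the torus 𝕋^{1+m}), and let η : ℝ × ℝ^m → ℝ^m be a smooth ℤ^{1+m}-periodic map. Define G(ε) := ∫_{[0,1]^m} ∫_0^1 [ α_θ(θ, y + ε η(θ,y)) + ε ⟨α_y(θ, y + ε η(θ,y)), ∂_θ η(θ,y)⟩ ] dθ dy, the average over y of the integrals of α along the perturbed loops t ↦ (t, y + ε η(t,y)). Then G is differentiable at ε = 0 and G'(0) = ∫_{[0,1]^m} ∫_0^1 [ ⟨α_y(θ,y), ∂_θ η(θ,y)⟩ − α_θ(θ,y) (∇_y · η)(θ,y) ] dθ dy, where ∇_y · η = Σ_i ∂η_i/∂y_i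 is the divergence of η in the y-variables. -/
open Set Function MeasureTheory

noncomputable section

/-- A map on `ℝ × ℝ^m` (coordinates `(θ, y)`) is `ℤ^{1+m}`-periodic if it is invariant
under all integer translations; such maps correspond to objects on the torus `𝕋^{1+m}`. -/
def ZPeriodicProd {m : ℕ} {α : Type*} (f : ℝ × (Fin m → ℝ) → α) : Prop :=
  ∀ (a : ℤ) (k : Fin m → ℤ) (θ : ℝ) (y : Fin m → ℝ),
    f (θ + a, y + fun i => (k i : ℝ)) = f (θ, y)

theorem exists_continuous_prod_add_smul {ι X : Type*} [TopologicalSpace X] (s : Finset ι)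
    (a : ι → ℝ) (b : ι → X → ℝ) (hb : ∀ i, Continuous (b i)) :
    ∃ q : ℝ × X → ℝ, Continuous q ∧
      ∀ r x, ∏ i ∈ s, (a i + r * b i x) = ∏ i ∈ s, a i + r * q (r, x) := by
  classical
  induction s using Finset.induction_on with
  | empty => exact ⟨0, continuous_zero, by simp⟩
  | insert i s hi ih =>
    obtain ⟨q, hq, h⟩ := ih
    refine ⟨fun p => b i p.2 * (∏ j ∈ s, a j + p.1 * q p) + a i * q p, ?_, fun r x => ?_⟩
    · have := hb i
      fun_prop
    · rw [Finset.prod_insert hi, Finset.prod_insert hi, h]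
      ring

theorem Matrix.exists_continuous_det_one_add_smul {n : Type*} [Fintype n] [DecidableEq n] :
    ∃ q : ℝ × Matrix n n ℝ → ℝ, Continuous q ∧
      (∀ r M, (1 + r • M).det = 1 + r * q (r, M)) ∧ ∀ M, q (0, M) = M.trace := by
  have key := fun σ : Equiv.Perm n => exists_continuous_prod_add_smul Finset.univ
    (fun i => (1 : Matrix n n ℝ) (σ i) i) (fun i (M : Matrix n n ℝ) => M (σ i) i)
    (fun i => by fun_prop)
  choose q hq h using key
  have hdet : ∀ r (M : Matrix n n ℝ), (1 + r • M).det =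
      1 + r * ∑ σ : Equiv.Perm n, ((Equiv.Perm.sign σ : ℤ) : ℝ) * q σ (r, M) := by
    intro r M
    have h1 : (1 : ℝ) = (1 : Matrix n n ℝ).det := Matrix.det_one.symm
    rw [Matrix.det_apply', h1, Matrix.det_apply', Finset.mul_sum, ← Finset.sum_add_distrib]
    refine Finset.sum_congr rfl fun σ _ => ?_
    simp only [Matrix.add_apply, Matrix.smul_apply, smul_eq_mul, h]
    ring
  have hc : Continuous fun p : ℝ × Matrix n n ℝ =>
      ∑ σ : Equiv.Perm n, ((Equiv.Perm.sign σ : ℤ) : ℝ) * q σ p := by fun_prop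
  refine ⟨_, hc, hdet, fun M => ?_⟩
  set P := (1 + (Polynomial.X : Polynomial ℝ) • M.map Polynomial.C).det.divX.divX with hP
  have heq : (fun r : ℝ => ∑ σ : Equiv.Perm n, ((Equiv.Perm.sign σ : ℤ) : ℝ) * q σ (r, M)) =
      fun r => M.trace + P.eval r * r := by
    refine Continuous.ext_on (dense_compl_singleton (0 : ℝ)) (by fun_prop) (by fun_prop) ?_
    intro r hr
    have h1 := hdet r M
    rw [Matrix.det_one_add_smul, ← hP] at h1
    refine mul_left_cancel₀ (show r ≠ 0 from hr) ?_
    simp only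
    linarith
  simpa using congrFun heq 0

theorem setIntegral_Icc_comp_add_mul_det {m : ℕ} {f : (Fin m → ℝ) → ℝ}
    {u : (Fin m → ℝ) → Fin m → ℝ} {u' : (Fin m → ℝ) → (Fin m → ℝ) →L[ℝ] (Fin m → ℝ)}
    (hf : ∀ (k : Fin m → ℤ) y, f (y + fun i => (k i : ℝ)) = f y)
    (hu : ∀ (k : Fin m → ℤ) y, u (y + fun i => (k i : ℝ)) = u y)
    (hu' : ∀ y, HasFDerivAt u (u' y) y) (hlip : LipschitzWith (1 / 2) u)
    (hdet : ∀ y ∈ Icc (0 : Fin m → ℝ) 1, 0 ≤ (ContinuousLinearMap.id ℝ _ + u' y).det) :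
    ∫ y in Icc (0 : Fin m → ℝ) 1, f (y + u y) * (ContinuousLinearMap.id ℝ _ + u' y).det =
      ∫ y in Icc (0 : Fin m → ℝ) 1, f y := by
  have happ : ApproximatesLinearOn (fun y => y + u y)
      (ContinuousLinearEquiv.refl ℝ (Fin m → ℝ) : (Fin m → ℝ) →L[ℝ] (Fin m → ℝ)) univ
      (1 / 2) := by
    intro x _ y _
    have := hlip.dist_le_mul x y
    rw [dist_eq_norm, dist_eq_norm] at this
    have e : x + u x - (y + u y) - (x - y) = u x - u y := by abel
    change ‖x + u x - (y + u y) - (x - y)‖ ≤ _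
    rwa [e]
  have hsub : Subsingleton (Fin m → ℝ) ∨
      (1 / 2 : NNReal) < ‖((ContinuousLinearEquiv.refl ℝ (Fin m → ℝ)).symm :
        (Fin m → ℝ) →L[ℝ] (Fin m → ℝ))‖₊⁻¹ := by
    rcases subsingleton_or_nontrivial (Fin m → ℝ) with h | h
    · exact Or.inl h
    · right
      have : ‖((ContinuousLinearEquiv.refl ℝ (Fin m → ℝ)).symm :
        (Fin m → ℝ) →L[ℝ] (Fin m → ℝ))‖₊ = 1 := by
        ext
        exact ContinuousLinearMap.norm_id
      rw [this, inv_one]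
      exact NNReal.half_lt_self one_ne_zero
  let Φ := happ.toHomeomorph _ hsub
  have hΦ : ∀ y, Φ y = y + u y := fun y => rfl
  set b := Pi.basisFun ℝ (Fin m)
  have hint : ∀ g : (Submodule.span ℤ (range b)).toAddSubgroup,
      ∃ k : Fin m → ℤ, (g : Fin m → ℝ) = fun i => (k i : ℝ) := by
    intro g
    have := (b.mem_span_iff_repr_mem ℤ (g : Fin m → ℝ)).1 g.2
    choose k hk using this
    exact ⟨k, funext fun i => by simpa [b] using (hk i).symm⟩
  have : Countable (Submodule.span ℤ (range b)).toAddSubgroup :=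
    inferInstanceAs (Countable (Submodule.span ℤ (range b)))
  have hD := ZSpan.isAddFundamentalDomain' b (volume : Measure (Fin m → ℝ))
  have hDm : MeasurableSet (ZSpan.fundamentalDomain b) := ZSpan.fundamentalDomain_measurableSet b
  have hD2 : IsAddFundamentalDomain (Submodule.span ℤ (range b)).toAddSubgroup
      (Φ '' ZSpan.fundamentalDomain b) (volume : Measure (Fin m → ℝ)) := by
    refine IsAddFundamentalDomain.mk'
      ((Φ.toMeasurableEquiv.measurableSet_image).2 hDm).nullMeasurableSet fun x => ?_
    obtain ⟨z, rfl⟩ := Φ.surjective x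
    have hiff : ∀ g : (Submodule.span ℤ (range b)).toAddSubgroup,
        g +ᵥ Φ z ∈ Φ '' ZSpan.fundamentalDomain b ↔ g +ᵥ z ∈ ZSpan.fundamentalDomain b := by
      intro g
      obtain ⟨k, hk⟩ := hint g
      have : g +ᵥ Φ z = Φ (g +ᵥ z) := by
        simp only [AddSubgroup.vadd_def, vadd_eq_add, hΦ]
        rw [hk, add_comm _ z, hu]
        abel
      rw [this, Φ.injective.mem_set_image]
    simp only [hiff]
    exact ZSpan.exist_unique_vadd_mem_fundamentalDomain b z
  have hae : (ZSpan.fundamentalDomain b) =ᵐ[volume] Icc (0 : Fin m → ℝ) 1 := by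
    rw [ZSpan.fundamentalDomain_pi_basisFun]
    exact Measure.univ_pi_Ico_ae_eq_Icc
  have hsubset : ZSpan.fundamentalDomain b ⊆ Icc (0 : Fin m → ℝ) 1 := by
    rw [ZSpan.fundamentalDomain_pi_basisFun]
    exact fun y hy => ⟨fun i => (hy i trivial).1, fun i => (hy i trivial).2.le⟩
  have hderiv : ∀ y, HasFDerivAt Φ (ContinuousLinearMap.id ℝ _ + u' y) y :=
    fun y => (hasFDerivAt_id y).add (hu' y)
  symm
  rw [← setIntegral_congr_set hae, ← setIntegral_congr_set hae, hD.setIntegral_eq hD2,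
    integral_image_eq_integral_abs_det_fderiv_smul volume hDm
      (fun y _ => (hderiv y).hasFDerivWithinAt) Φ.injective.injOn]
  · refine setIntegral_congr_fun hDm fun y hy => ?_
    simp only [smul_eq_mul, abs_of_nonneg (hdet y (hsubset hy)), hΦ, mul_comm]
  · intro g x
    obtain ⟨k, hk⟩ := hint g
    rw [AddSubgroup.vadd_def, vadd_eq_add, hk, add_comm, hf]

theorem ZPeriodicProd.exists_norm_le {m : ℕ} {F : Type*} [SeminormedAddCommGroup F]
    {g : ℝ × (Fin m → ℝ) → F} (hper : ZPeriodicProd g) (hg : Continuous g) :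
    ∃ C : ℝ, ∀ p, ‖g p‖ ≤ C := by
  obtain ⟨C, hC⟩ := (isCompact_Icc (a := (0 : ℝ × (Fin m → ℝ))) (b := 1)).exists_bound_of_continuousOn
    hg.continuousOn
  refine ⟨C, fun p => ?_⟩
  obtain ⟨θ, y⟩ := p
  have h := hper ⌊θ⌋ (fun i => ⌊y i⌋) (Int.fract θ) (fun i => Int.fract (y i))
  have hy : ((fun i => Int.fract (y i)) + fun i => (⌊y i⌋ : ℝ)) = y :=
    funext fun i => Int.fract_add_floor (y i)
  rw [Int.fract_add_floor, hy] at h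
  rw [h]
  exact hC _ ⟨⟨Int.fract_nonneg θ, fun i => Int.fract_nonneg (y i)⟩,
    ⟨(Int.fract_lt_one θ).le, fun i => (Int.fract_lt_one (y i)).le⟩⟩

theorem ZPeriodicProd.fderiv {m : ℕ} {F : Type*} [NormedAddCommGroup F] [NormedSpace ℝ F]
    {g : ℝ × (Fin m → ℝ) → F} (hper : ZPeriodicProd g) : ZPeriodicProd (fderiv ℝ g) := by
  intro a k θ y
  have h : (fun p => g (p + ((a : ℝ), fun i => (k i : ℝ)))) = g :=
    funext fun p => hper a k p.1 p.2
  have h2 := fderiv_comp_add_right (𝕜 := ℝ) (f := g) (x := (θ, y)) ((a : ℝ), fun i => (k i : ℝ))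
  rw [h] at h2
  exact h2.symm

/-- The matrix of the partial derivative of `η` in the `y`-variables. -/
def partialJacobian {m : ℕ} (η : ℝ × (Fin m → ℝ) → (Fin m → ℝ)) (p : ℝ × (Fin m → ℝ)) :
    Matrix (Fin m) (Fin m) ℝ :=
  Matrix.of fun i j => fderiv ℝ η p (0, Pi.single j 1) i

theorem ContDiff.continuous_partialJacobian {m : ℕ} {η : ℝ × (Fin m → ℝ) → (Fin m → ℝ)}
    (hη : ContDiff ℝ 1 η) : Continuous (partialJacobian η) := by
  have := hη.continuous_fderiv one_ne_zero
  refine continuous_matrix fun i j => ?_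
  simp only [partialJacobian, Matrix.of_apply]
  fun_prop

theorem det_id_add_smul_fderiv_comp_inr {m : ℕ} (η : ℝ × (Fin m → ℝ) → (Fin m → ℝ))
    (p : ℝ × (Fin m → ℝ)) (ε : ℝ) :
    (ContinuousLinearMap.id ℝ (Fin m → ℝ) +
      ε • (fderiv ℝ η p).comp (ContinuousLinearMap.inr ℝ ℝ (Fin m → ℝ))).det =
      (1 + ε • partialJacobian η p).det := by
  rw [ContinuousLinearMap.det, ← LinearMap.det_toMatrix']
  congr 1
  ext i j
  simp [LinearMap.toMatrix'_apply, partialJacobian, Matrix.one_apply, Pi.single_apply]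

theorem integral_Icc_intervalIntegral_swap {m : ℕ} {F : (Fin m → ℝ) → ℝ → ℝ}
    (hF : Continuous (uncurry F)) :
    ∫ y in Icc (0 : Fin m → ℝ) 1, ∫ θ in (0 : ℝ)..1, F y θ =
      ∫ θ in (0 : ℝ)..1, ∫ y in Icc (0 : Fin m → ℝ) 1, F y θ := by
  symm
  refine intervalIntegral_integral_swap ?_
  rw [Measure.prod_restrict, uIoc_of_le zero_le_one]
  have hc : Continuous (uncurry fun θ y => F y θ) := hF.comp continuous_swap
  have := hc.continuousOn.integrableOn_compact (μ := (volume : Measure ℝ).prod volume)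
    ((isCompact_Icc (a := (0 : ℝ)) (b := 1)).prod (isCompact_Icc (a := (0 : Fin m → ℝ)) (b := 1)))
  exact this.mono_set (prod_mono Ioc_subset_Icc_self subset_rfl)

theorem hasDerivAt_add_mul_of_continuousAt {G H : ℝ → ℝ} {c : ℝ}
    (hH : ContinuousAt H 0) (hG : ∀ᶠ ε in nhds 0, G ε = c + ε * H ε) :
    HasDerivAt G (H 0) 0 := by
  have h : HasDerivAt (fun ε => c + ε * H ε) (H 0) 0 := by
    rw [hasDerivAt_iff_tendsto_slope]
    refine (hH.tendsto.mono_left nhdsWithin_le_nhds).congr' ?_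
    filter_upwards [self_mem_nhdsWithin] with ε hε
    have : ε ≠ 0 := hε
    simp [slope_def_field]
    field_simp
  exact h.congr_of_eventuallyEq hG

theorem averaged_comp_mul_det {m : ℕ} {f : ℝ × (Fin m → ℝ) → ℝ}
    (hf : ZPeriodicProd f) (hfc : Continuous f) {η : ℝ × (Fin m → ℝ) → (Fin m → ℝ)}
    (hη : ContDiff ℝ 1 η) (hηper : ZPeriodicProd η) :
    ∀ᶠ ε in nhds (0 : ℝ),
      ∫ y in Icc (0 : Fin m → ℝ) 1, ∫ θ in (0 : ℝ)..1,
          f (θ, y + ε • η (θ, y)) * (1 + ε • partialJacobian η (θ, y)).det =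
        ∫ y in Icc (0 : Fin m → ℝ) 1, ∫ θ in (0 : ℝ)..1, f (θ, y) := by
  have hJ := hη.continuous_partialJacobian
  obtain ⟨C, hC⟩ := hηper.fderiv.exists_norm_le (hη.continuous_fderiv one_ne_zero)
  have hsmall : ∀ᶠ ε in nhds (0 : ℝ), |ε| * C < 1 / 2 :=
    ContinuousAt.eventually_lt (by fun_prop) continuousAt_const (by norm_num)
  have hpos : ∀ᶠ ε in nhds (0 : ℝ), ∀ p ∈ Icc (0 : ℝ × (Fin m → ℝ)) 1,
      0 < (1 + ε • partialJacobian η p).det := by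
    refine isCompact_Icc.eventually_forall_of_forall_eventually fun p _ => ?_
    refine ContinuousAt.eventually_lt continuousAt_const ?_ ?_
    · exact Continuous.continuousAt (by fun_prop)
    · simp
  filter_upwards [hsmall, hpos] with ε hε hdet
  rw [integral_Icc_intervalIntegral_swap, integral_Icc_intervalIntegral_swap]
  · refine intervalIntegral.integral_congr fun θ hθ => ?_
    rw [uIcc_of_le zero_le_one] at hθ
    have hder : ∀ y, HasFDerivAt (fun y => ε • η (θ, y))
        (ε • (fderiv ℝ η (θ, y)).comp (ContinuousLinearMap.inr ℝ ℝ (Fin m → ℝ))) y := by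
      intro y
      have h1 : HasFDerivAt (fun y : Fin m → ℝ => (θ, y))
          (ContinuousLinearMap.inr ℝ ℝ (Fin m → ℝ)) y := hasFDerivAt_prodMk_right θ y
      have h2 := ((hη.differentiable one_ne_zero) (θ, y)).hasFDerivAt
      exact (h2.comp y h1).const_smul ε
    have := setIntegral_Icc_comp_add_mul_det (f := fun y => f (θ, y))
      (u := fun y => ε • η (θ, y))
      (fun k y => by simpa using hf 0 k θ y)
      (fun k y => by simpa using congrArg (ε • ·) (hηper 0 k θ y)) hder ?_ ?_
    · simpa only [det_id_add_smul_fderiv_comp_inr] using this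
    · refine lipschitzWith_of_nnnorm_fderiv_le (𝕜 := ℝ) (fun y => (hder y).differentiableAt)
        fun y => ?_
      rw [(hder y).fderiv, ← NNReal.coe_le_coe, coe_nnnorm, norm_smul, Real.norm_eq_abs]
      have h3 : ‖(fderiv ℝ η (θ, y)).comp (ContinuousLinearMap.inr ℝ ℝ (Fin m → ℝ))‖ ≤ C := by
        refine (ContinuousLinearMap.opNorm_comp_le _ _).trans ?_
        refine (mul_le_of_le_one_right (norm_nonneg _)
          (ContinuousLinearMap.norm_inr_le_one ℝ ℝ _)).trans (hC _)
      refine (mul_le_mul_of_nonneg_left h3 (abs_nonneg ε)).trans (hε.le.trans ?_)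
      simp
    · intro y hy
      rw [det_id_add_smul_fderiv_comp_inr]
      exact (hdet (θ, y) ⟨⟨hθ.1, hy.1⟩, ⟨hθ.2, hy.2⟩⟩).le
  · simp only [uncurry_def]
    fun_prop
  · have := hη.continuous
    simp only [uncurry_def]
    fun_prop

/-- Let `α = (α_θ, α_y)` be a continuous `ℤ^{1+m}`-periodic 1-form on
`𝕋^{1+m}` (`m ≥ 1`) and `η` a smooth `ℤ^{1+m}`-periodic vector field in the `y`
directions. Let `G(ε)` be the average over `y ∈ [0,1]^m` of the integrals of `α` along
the perturbed loops `t ↦ (t, y + ε η(t,y))`. Then `G` is differentiable at `ε = 0` with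
`G'(0) = ∫∫ [⟨α_y, ∂_θ η⟩ − α_θ (∇_y · η)] dθ dy`. -/
theorem averaged_loop_integral_derivative
    (m : ℕ) (hm : 1 ≤ m)
    (α : ℝ × (Fin m → ℝ) → ℝ × (Fin m → ℝ))
    (hα : Continuous α) (hαper : ZPeriodicProd α)
    (η : ℝ × (Fin m → ℝ) → (Fin m → ℝ))
    (hη : ContDiff ℝ (⊤ : ℕ∞) η) (hηper : ZPeriodicProd η) :
    HasDerivAt
      (fun ε : ℝ =>
        ∫ y in Icc (0 : Fin m → ℝ) 1,
          ∫ θ in (0:ℝ)..1,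
            ((α (θ, y + ε • η (θ, y))).1
              + ε * ∑ i, (α (θ, y + ε • η (θ, y))).2 i * fderiv ℝ η (θ, y) (1, 0) i))
      (∫ y in Icc (0 : Fin m → ℝ) 1,
        ∫ θ in (0:ℝ)..1,
          ((∑ i, (α (θ, y)).2 i * fderiv ℝ η (θ, y) (1, 0) i)
            - (α (θ, y)).1 * ∑ i, fderiv ℝ η (θ, y) (0, Pi.single i 1) i))
      0 := by
  have hη1 : ContDiff ℝ 1 η := hη.of_le (by exact_mod_cast le_top)
  have hJ := hη1.continuous_partialJacobian
  have hηc := hη.continuous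
  have hη' := hη1.continuous_fderiv one_ne_zero
  obtain ⟨q, hq, hdet, htrace⟩ := Matrix.exists_continuous_det_one_add_smul (n := Fin m)
  let S : ℝ → (Fin m → ℝ) → ℝ → ℝ := fun ε y θ =>
    ∑ i, (α (θ, y + ε • η (θ, y))).2 i * fderiv ℝ η (θ, y) (1, 0) i
  let T : ℝ → (Fin m → ℝ) → ℝ → ℝ := fun ε y θ =>
    (α (θ, y + ε • η (θ, y))).1 * (1 + ε • partialJacobian η (θ, y)).det
  let K : ℝ → (Fin m → ℝ) → ℝ → ℝ := fun ε y θ =>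
    S ε y θ - (α (θ, y + ε • η (θ, y))).1 * q (ε, partialJacobian η (θ, y))
  have hK : Continuous fun p : (ℝ × (Fin m → ℝ)) × ℝ => K p.1.1 p.1.2 p.2 := by
    simp only [K, S]
    fun_prop
  have hT : Continuous fun p : (ℝ × (Fin m → ℝ)) × ℝ => T p.1.1 p.1.2 p.2 := by
    simp only [T]
    fun_prop
  have hKint : Continuous fun p : ℝ × (Fin m → ℝ) => ∫ θ in (0 : ℝ)..1, K p.1 p.2 θ :=
    intervalIntegral.continuous_parametric_intervalIntegral_of_continuous'
      (f := fun (p : ℝ × (Fin m → ℝ)) θ => K p.1 p.2 θ) hK 0 1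
  have hTint : Continuous fun p : ℝ × (Fin m → ℝ) => ∫ θ in (0 : ℝ)..1, T p.1 p.2 θ :=
    intervalIntegral.continuous_parametric_intervalIntegral_of_continuous'
      (f := fun (p : ℝ × (Fin m → ℝ)) θ => T p.1 p.2 θ) hT 0 1
  have hH : Continuous fun ε => ∫ y in Icc (0 : Fin m → ℝ) 1, ∫ θ in (0 : ℝ)..1, K ε y θ :=
    continuous_parametric_integral_of_continuous
      (f := fun ε y => ∫ θ in (0 : ℝ)..1, K ε y θ) hKint isCompact_Icc
  have hα1 : ZPeriodicProd fun p => (α p).1 := fun a k θ y => congrArg Prod.fst (hαper a k θ y)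
  have hH0 : (∫ y in Icc (0 : Fin m → ℝ) 1, ∫ θ in (0 : ℝ)..1, K 0 y θ) =
      ∫ y in Icc (0 : Fin m → ℝ) 1, ∫ θ in (0:ℝ)..1,
        ((∑ i, (α (θ, y)).2 i * fderiv ℝ η (θ, y) (1, 0) i)
          - (α (θ, y)).1 * ∑ i, fderiv ℝ η (θ, y) (0, Pi.single i 1) i) := by
    simp [K, S, htrace, Matrix.trace, partialJacobian]
  rw [← hH0]
  refine hasDerivAt_add_mul_of_continuousAt
    (c := ∫ y in Icc (0 : Fin m → ℝ) 1, ∫ θ in (0 : ℝ)..1, (α (θ, y)).1) hH.continuousAt ?_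
  filter_upwards [averaged_comp_mul_det hα1 (by fun_prop) hη1 hηper] with ε hε
  rw [← hε, ← integral_const_mul, ← integral_add]
  · refine integral_congr_ae (Filter.Eventually.of_forall fun y => ?_)
    simp only
    rw [← intervalIntegral.integral_const_mul, ← intervalIntegral.integral_add]
    · refine intervalIntegral.integral_congr fun θ _ => ?_
      simp only [K, S, hdet]
      ring
    · exact (hT.comp (by fun_prop : Continuous fun θ : ℝ => ((ε, y), θ))).intervalIntegrable _ _
    · exact ((hK.comp (by fun_prop : Continuous fun θ : ℝ => ((ε, y), θ))).const_mul
        ε).intervalIntegrable _ _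
  · exact (hTint.comp (by fun_prop : Continuous fun y : Fin m → ℝ =>
      (ε, y))).continuousOn.integrableOn_compact isCompact_Icc
  · exact ((hKint.comp (by fun_prop : Continuous fun y : Fin m → ℝ =>
      (ε, y))).const_mul ε).continuousOn.integrableOn_compact isCompact_Icc
end
end

section
/- Let K : ℝ × (ℝ^m × ℝ^m) → ℝ be a compactly supported C^2 time-dependent Hamiltonian on T*ℝ^m = ℝ^m × ℝ^m which is 1-periodic in time, K(t+1, z) = K(t, z), with Hamiltonian flow ψ^t = (Q(t,·), P(t,·)) satisfying ψ^{t+1} = ψ^t for all t (in particular ψ^1 = ψ^0 = id). Define F(t, x) := ∫_0^t [ ⟨P(s,x), ∂_s Q(s,x)⟩ − K(s, ψ^s(x)) ] ds. Then there is a constant c ∈ ℝ such that F(t+1, x) = F(t, x) + c for all t ∈ ℝ and all x ∈ ℝ^m × ℝ^m; consequently, after replacing K by K − c, the function F becomes 1-periodic in t. -/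
open Set Function MeasureTheory

noncomputable section

/-- The cotangent space `T^*ℝ^m = ℝ^m × ℝ^m` with coordinates `(q, p)`. -/
abbrev Phase (m : ℕ) := (Fin m → ℝ) × (Fin m → ℝ)

/-- The Hamiltonian vector field `X_K = (∂K/∂p, −∂K/∂q)` of `K : Phase m → ℝ`. -/
def sympGrad (m : ℕ) (K : Phase m → ℝ) (z : Phase m) : Phase m :=
  (fun i => fderiv ℝ K z (0, Pi.single i 1),
   fun i => -fderiv ℝ K z (Pi.single i 1, 0))

/-- `ψ` is the Hamiltonian flow of the time-dependent Hamiltonian `K`: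
`ψ^0 = id` and `(d/dt) ψ^t(z) = X_{K_t}(ψ^t(z))`. -/
def IsHamFlow (m : ℕ) (K : ℝ → Phase m → ℝ) (ψ : ℝ → Phase m → Phase m) : Prop :=
  (∀ z, ψ 0 z = z) ∧
  ∀ (z : Phase m) (t : ℝ), HasDerivAt (fun s => ψ s z) (sympGrad m (K t) (ψ t z)) t

/-- A time-dependent function on phase space is compactly supported if all its
time slices are supported in one fixed compact set. -/
def CompactlySupported (m : ℕ) (K : ℝ → Phase m → ℝ) : Prop :=
  ∃ C : Set (Phase m), IsCompact C ∧ ∀ t, Function.support (K t) ⊆ C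

/-- The classical action `F(t,x) = ∫_0^t [⟨P(s,x), ∂_s Q(s,x)⟩ − K(s, ψ^s(x))] ds`,
where `ψ^s(x) = (Q(s,x), P(s,x))`. -/
def actF (m : ℕ) (K : ℝ → Phase m → ℝ) (ψ : ℝ → Phase m → Phase m)
    (t : ℝ) (x : Phase m) : ℝ :=
  ∫ s in (0:ℝ)..t,
    ((∑ i, (ψ s x).2 i * deriv (fun u => (ψ u x).1 i) s) - K s (ψ s x))

/-- A map between normed spaces whose increments are quadratically small is constant. -/
theorem eq_of_norm_sub_le_sq {E F : Type*} [NormedAddCommGroup E] [NormedSpace ℝ E]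
    [NormedAddCommGroup F] [NormedSpace ℝ F] {f : E → F} {C : ℝ}
    (h : ∀ x y, ‖f y - f x‖ ≤ C * ‖y - x‖ ^ 2) (x y : E) : f x = f y := by
  have hd : ∀ x, HasFDerivAt f (0 : E →L[ℝ] F) x := by
    intro x
    rw [hasFDerivAt_iff_isLittleO]
    have h1 : (fun y => f y - f x - (0 : E →L[ℝ] F) (y - x)) =O[nhds x]
        fun y => ‖y - x‖ ^ 2 := by
      refine Asymptotics.IsBigO.of_bound C (Filter.Eventually.of_forall fun y => ?_)
      simpa using h x y
    refine h1.trans_isLittleO ?_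
    have h2 := (Asymptotics.isLittleO_norm_pow_id (E' := E) one_lt_two).comp_tendsto
      (k := fun y => y - x) (l' := nhds x)
      (by
        have : Continuous fun y : E => y - x := by fun_prop
        simpa using this.tendsto x)
    exact h2
  exact is_const_of_fderiv_eq_zero (𝕜 := ℝ) (fun x => (hd x).differentiableAt)
    (fun x => (hd x).fderiv) x y

/-- The spatial derivative of a jointly differentiable time-dependent function. -/
theorem hasFDerivAt_slice {E : Type*} [NormedAddCommGroup E] [NormedSpace ℝ E]
    {K : ℝ → E → ℝ} (hK : Differentiable ℝ (Function.uncurry K)) (t : ℝ) (z : E) :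
    HasFDerivAt (K t)
      ((fderiv ℝ (Function.uncurry K) (t, z)).comp (ContinuousLinearMap.inr ℝ ℝ E)) z := by
  have := (hK (t, z)).hasFDerivAt.comp z (hasFDerivAt_prodMk_right t z)
  exact this

/-- For a compactly supported `C^2` time-dependent function, the spatial derivative is Lipschitz,
uniformly for times in `[0, 1]`. -/
theorem exists_lipschitz_fderiv_slice {m : ℕ} {K : ℝ → Phase m → ℝ}
    (hK : ContDiff ℝ 2 (Function.uncurry K)) (hKsupp : CompactlySupported m K) :
    ∃ M : ℝ, 0 ≤ M ∧ ∀ t ∈ Icc (0 : ℝ) 1, ∀ z w,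
      ‖fderiv ℝ (K t) z - fderiv ℝ (K t) w‖ ≤ M * ‖z - w‖ := by
  obtain ⟨C, hC, hsupp⟩ := hKsupp
  set G := Function.uncurry K with hG
  have hD : ContDiff ℝ 1 (fderiv ℝ G) := hK.fderiv_right (by norm_num)
  have hD2 : Continuous (fderiv ℝ (fderiv ℝ G)) := hD.continuous_fderiv (by norm_num)
  obtain ⟨B, hB⟩ := ((isCompact_Icc (a := (0 : ℝ)) (b := 1)).prod hC).exists_bound_of_continuousOn
    (f := fderiv ℝ (fderiv ℝ G)) hD2.continuousOn
  have hzero : ∀ t z, z ∉ C → fderiv ℝ (fderiv ℝ G) (t, z) = 0 := by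
    intro t z hz
    have hev : G =ᶠ[nhds (t, z)] fun _ => (0 : ℝ) := by
      have ho : IsOpen (Prod.snd ⁻¹' Cᶜ : Set (ℝ × Phase m)) :=
        hC.isClosed.isOpen_compl.preimage continuous_snd
      filter_upwards [ho.mem_nhds (show (t, z) ∈ _ from hz)] with p hp
      by_contra hne
      exact hp (hsupp p.1 hne)
    rw [hev.fderiv.fderiv_eq]
    simp
  have hbound : ∀ t ∈ Icc (0 : ℝ) 1, ∀ z, ‖fderiv ℝ (fderiv ℝ G) (t, z)‖ ≤ max B 0 := by
    intro t ht z
    by_cases hz : z ∈ C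
    · exact (hB (t, z) ⟨ht, hz⟩).trans (le_max_left _ _)
    · rw [hzero t z hz]
      exact ContinuousLinearMap.opNorm_zero.le.trans (le_max_right _ _)
  refine ⟨max B 0, le_max_right _ _, fun t ht z w => ?_⟩
  have hinr : ‖ContinuousLinearMap.inr ℝ ℝ (Phase m)‖ ≤ 1 :=
    ContinuousLinearMap.norm_inr_le_one ℝ ℝ (Phase m)
  have hlip : ‖fderiv ℝ G (t, z) - fderiv ℝ G (t, w)‖ ≤ max B 0 * ‖z - w‖ := by
    refine convex_univ.norm_image_sub_le_of_norm_hasFDerivWithin_le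
      (f := fun z => fderiv ℝ G (t, z))
      (f' := fun z => (fderiv ℝ (fderiv ℝ G) (t, z)).comp (ContinuousLinearMap.inr ℝ ℝ (Phase m)))
      (fun u _ => ?_) (fun u _ => ?_) (mem_univ w) (mem_univ z)
    · exact ((hD.differentiable (by norm_num) (t, u)).hasFDerivAt.comp u
        (hasFDerivAt_prodMk_right t u)).hasFDerivWithinAt
    · refine (ContinuousLinearMap.opNorm_comp_le _ _).trans ?_
      exact (mul_le_of_le_one_right (norm_nonneg _) hinr).trans (hbound t ht u)
  have hdiff : Differentiable ℝ G := hK.differentiable (by norm_num)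
  rw [(hasFDerivAt_slice hdiff t z).fderiv, (hasFDerivAt_slice hdiff t w).fderiv,
    ← ContinuousLinearMap.sub_comp]
  exact (ContinuousLinearMap.opNorm_comp_le _ _).trans
    ((mul_le_of_le_one_right (norm_nonneg _) hinr).trans hlip)

/-- Quadratic Taylor remainder for a function with Lipschitz derivative. -/
theorem norm_taylor_remainder_le {E : Type*} [NormedAddCommGroup E] [NormedSpace ℝ E]
    {f : E → ℝ} {M : ℝ} (hM : 0 ≤ M) (hf : Differentiable ℝ f)
    (hlip : ∀ z w, ‖fderiv ℝ f z - fderiv ℝ f w‖ ≤ M * ‖z - w‖) (x y : E) :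
    ‖f y - f x - fderiv ℝ f x (y - x)‖ ≤ M * ‖y - x‖ ^ 2 := by
  have := (convex_closedBall x ‖y - x‖).norm_image_sub_le_of_norm_fderiv_le'
    (f := f) (φ := fderiv ℝ f x) (C := M * ‖y - x‖) (x := x) (y := y) (fun z _ => hf z)
    (fun z hz => (hlip z x).trans
      (mul_le_mul_of_nonneg_left (by simpa [dist_eq_norm] using hz) hM))
    (by simp) (by simp [dist_eq_norm])
  calc _ ≤ _ := this
    _ = _ := by ring

/-- A covector on phase space in coordinates. -/
theorem apply_eq_sum_coords {m : ℕ} (L : Phase m →L[ℝ] ℝ) (z : Phase m) :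
    L z = ∑ i, (z.1 i * L (Pi.single i 1, 0) + z.2 i * L (0, Pi.single i 1)) := by
  have hz : z = ∑ i, (z.1 i • ((Pi.single i 1, 0) : Phase m)
      + z.2 i • ((0, Pi.single i 1) : Phase m)) := by
    ext j <;> simp [Prod.fst_sum, Prod.snd_sum, Finset.sum_apply, Pi.single_apply]
  conv_lhs => rw [hz]
  simp only [map_sum, map_add, map_smul, smul_eq_mul]

theorem norm_position_single {m : ℕ} (i : Fin m) : ‖((Pi.single i 1, 0) : Phase m)‖ = 1 := by
  simp [Prod.norm_def, Pi.norm_single]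

theorem norm_momentum_single {m : ℕ} (i : Fin m) : ‖((0, Pi.single i 1) : Phase m)‖ = 1 := by
  simp [Prod.norm_def, Pi.norm_single]

theorem norm_sympGrad_sub_le {m : ℕ} {f : Phase m → ℝ} (z w : Phase m) :
    ‖sympGrad m f z - sympGrad m f w‖ ≤ ‖fderiv ℝ f z - fderiv ℝ f w‖ := by
  refine norm_prod_le_iff.2 ⟨(pi_norm_le_iff_of_nonneg (norm_nonneg _)).2 fun i => ?_,
    (pi_norm_le_iff_of_nonneg (norm_nonneg _)).2 fun i => ?_⟩
  · have := (fderiv ℝ f z - fderiv ℝ f w).le_opNorm ((0, Pi.single i 1) : Phase m)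
    rw [norm_momentum_single, mul_one] at this
    exact this
  · have := (fderiv ℝ f z - fderiv ℝ f w).le_opNorm ((Pi.single i 1, 0) : Phase m)
    rw [norm_position_single, mul_one, ← norm_neg] at this
    simpa [sympGrad, neg_add_eq_sub, sub_eq_add_neg, add_comm] using this

namespace IsHamFlow

variable {m : ℕ} {K : ℝ → Phase m → ℝ} {ψ : ℝ → Phase m → Phase m}

theorem continuous_orbit (hψ : IsHamFlow m K ψ) (x : Phase m) : Continuous fun s => ψ s x :=
  continuous_iff_continuousAt.2 fun t => (hψ.2 x t).continuousAt

theorem hasDerivAt_position (hψ : IsHamFlow m K ψ) (x : Phase m) (i : Fin m) (t : ℝ) :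
    HasDerivAt (fun s => (ψ s x).1 i) (fderiv ℝ (K t) (ψ t x) (0, Pi.single i 1)) t :=
  hasDerivAt_pi.1 (hψ.2 x t).fst i

theorem hasDerivAt_momentum (hψ : IsHamFlow m K ψ) (x : Phase m) (i : Fin m) (t : ℝ) :
    HasDerivAt (fun s => (ψ s x).2 i) (-fderiv ℝ (K t) (ψ t x) (Pi.single i 1, 0)) t :=
  hasDerivAt_pi.1 (hψ.2 x t).snd i

/-- Hamiltonian flows are Lipschitz in the initial condition, uniformly for times in `[0, 1]`. -/
theorem norm_sub_le (hψ : IsHamFlow m K ψ) {M : ℝ} (hM : 0 ≤ M)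
    (hlip : ∀ t ∈ Icc (0 : ℝ) 1, ∀ z w,
      ‖fderiv ℝ (K t) z - fderiv ℝ (K t) w‖ ≤ M * ‖z - w‖)
    (x y : Phase m) {t : ℝ} (ht : t ∈ Icc (0 : ℝ) 1) :
    ‖ψ t y - ψ t x‖ ≤ Real.exp M * ‖y - x‖ := by
  have h := dist_le_of_trajectories_ODE_of_mem (K := M.toNNReal) (a := 0) (b := 1)
    (v := fun t => sympGrad m (K t)) (s := fun _ => univ) (δ := ‖y - x‖)
    (f := fun s => ψ s y) (g := fun s => ψ s x)
    (fun t ht => LipschitzOnWith.of_dist_le_mul fun z _ w _ => by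
      rw [dist_eq_norm, dist_eq_norm, Real.coe_toNNReal M hM]
      exact (norm_sympGrad_sub_le z w).trans (hlip t ⟨ht.1, ht.2.le⟩ z w))
    (hψ.continuous_orbit y).continuousOn (fun t _ => (hψ.2 y t).hasDerivWithinAt)
    (fun _ _ => mem_univ _)
    (hψ.continuous_orbit x).continuousOn (fun t _ => (hψ.2 x t).hasDerivWithinAt)
    (fun _ _ => mem_univ _) (by simp [hψ.1, dist_eq_norm]) t ht
  rw [dist_eq_norm, Real.coe_toNNReal M hM, sub_zero, mul_comm] at h
  refine h.trans (mul_le_mul_of_nonneg_right (Real.exp_le_exp.2 ?_) (norm_nonneg _))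
  exact mul_le_of_le_one_right hM ht.2

/-- The integrand of the action is continuous in time along every orbit. -/
theorem continuous_actionIntegrand (hψ : IsHamFlow m K ψ)
    (hK : ContDiff ℝ 2 (Function.uncurry K)) (x : Phase m) :
    Continuous fun s => (∑ i, (ψ s x).2 i * deriv (fun u => (ψ u x).1 i) s) - K s (ψ s x) := by
  have horb := hψ.continuous_orbit x
  have hdiff : Differentiable ℝ (Function.uncurry K) := hK.differentiable (by norm_num)
  have hKc : Continuous fun s => K s (ψ s x) :=
    hK.continuous.comp (continuous_id.prodMk horb)
  have hD := (hK.continuous_fderiv (by norm_num)).comp (continuous_id.prodMk horb)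
  refine Continuous.sub (continuous_finsetSum _ fun i _ => ?_) hKc
  simp_rw [(hψ.hasDerivAt_position x i _).deriv, (hasFDerivAt_slice hdiff _ _).fderiv]
  refine Continuous.mul (by fun_prop) ?_
  exact hD.clm_apply continuous_const

/-- If all orbits of a Hamiltonian flow close up at time one, the actions of two orbits differ by
a quantity that is quadratic in the distance of the initial conditions: closed orbits are critical
points of the action functional. -/
theorem norm_actF_sub_le (hψ : IsHamFlow m K ψ) (hK : ContDiff ℝ 2 (Function.uncurry K))
    (hclosed : ∀ z, ψ 1 z = z) {M : ℝ} (hM : 0 ≤ M)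
    (hlip : ∀ t ∈ Icc (0 : ℝ) 1, ∀ z w,
      ‖fderiv ℝ (K t) z - fderiv ℝ (K t) w‖ ≤ M * ‖z - w‖) (x y : Phase m) :
    ‖actF m K ψ 1 y - actF m K ψ 1 x‖ ≤
      (m + 1) * M * Real.exp M ^ 2 * ‖y - x‖ ^ 2 := by
  have hdiff : Differentiable ℝ (Function.uncurry K) := hK.differentiable (by norm_num)
  let L : Phase m → ℝ → ℝ := fun x s =>
    (∑ i, (ψ s x).2 i * deriv (fun u => (ψ u x).1 i) s) - K s (ψ s x)
  have hL : ∀ x, Continuous (L x) := hψ.continuous_actionIntegrand hK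
  let h : ℝ → ℝ := fun s => ∑ i, (ψ s x).2 i * ((ψ s y).1 i - (ψ s x).1 i)
  let h' : ℝ → ℝ := fun s => ∑ i,
    (-fderiv ℝ (K s) (ψ s x) (Pi.single i 1, 0) * ((ψ s y).1 i - (ψ s x).1 i)
      + (ψ s x).2 i * (fderiv ℝ (K s) (ψ s y) (0, Pi.single i 1)
        - fderiv ℝ (K s) (ψ s x) (0, Pi.single i 1)))
  have hh : ∀ s, HasDerivAt h (h' s) s := fun s => HasDerivAt.fun_sum fun i _ =>
    (hψ.hasDerivAt_momentum x i s).mul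
      ((hψ.hasDerivAt_position y i s).sub (hψ.hasDerivAt_position x i s))
  have hh'c : Continuous h' := by
    have hox := hψ.continuous_orbit x
    have hoy := hψ.continuous_orbit y
    have hDx := (hK.continuous_fderiv (by norm_num)).comp (continuous_id.prodMk hox)
    have hDy := (hK.continuous_fderiv (by norm_num)).comp (continuous_id.prodMk hoy)
    have hcx : ∀ v, Continuous fun s => fderiv ℝ (K s) (ψ s x) v := fun v => by
      simp_rw [(hasFDerivAt_slice hdiff _ _).fderiv]
      exact hDx.clm_apply continuous_const
    have hcy : ∀ v, Continuous fun s => fderiv ℝ (K s) (ψ s y) v := fun v => by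
      simp_rw [(hasFDerivAt_slice hdiff _ _).fderiv]
      exact hDy.clm_apply continuous_const
    refine continuous_finsetSum _ fun i _ => ?_
    exact ((hcx _).neg.mul (by fun_prop)).add
      (Continuous.mul (by fun_prop) ((hcy _).sub (hcx _)))
  have hint : ∫ s in (0 : ℝ)..1, h' s = 0 := by
    rw [intervalIntegral.integral_eq_sub_of_hasDerivAt (fun s _ => hh s)
      (hh'c.intervalIntegrable _ _)]
    simp [h, hclosed, hψ.1]
  have hsplit : actF m K ψ 1 y - actF m K ψ 1 x =
      ∫ s in (0 : ℝ)..1, (L y s - L x s - h' s) := by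
    rw [intervalIntegral.integral_sub (f := fun s => L y s - L x s)
      (((hL y).sub (hL x)).intervalIntegrable _ _)
      (hh'c.intervalIntegrable _ _), hint, sub_zero,
      intervalIntegral.integral_sub ((hL y).intervalIntegrable _ _)
      ((hL x).intervalIntegrable _ _)]
    rfl
  rw [hsplit]
  have hbd : ∀ s ∈ Icc (0 : ℝ) 1, ‖L y s - L x s - h' s‖ ≤
      (m + 1) * M * Real.exp M ^ 2 * ‖y - x‖ ^ 2 := by
    intro s hs
    set δ := ψ s y - ψ s x with hδ
    have hrem : L y s - L x s - h' s =
        (∑ i, δ.2 i * (fderiv ℝ (K s) (ψ s y) - fderiv ℝ (K s) (ψ s x)) (0, Pi.single i 1))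
          - (K s (ψ s y) - K s (ψ s x) - fderiv ℝ (K s) (ψ s x) δ) := by
      rw [apply_eq_sum_coords (fderiv ℝ (K s) (ψ s x)) δ]
      simp only [L, h', (hψ.hasDerivAt_position x _ s).deriv,
        (hψ.hasDerivAt_position y _ s).deriv]
      have : ∀ a b c d e f u v : ℝ, a - u - (b - v) - c = d - (u - v - e) ↔ a - b - c = d + e :=
        fun a b c d e f u v => by constructor <;> intro h <;> linarith
      rw [this _ _ _ _ _ 0, ← Finset.sum_sub_distrib, ← Finset.sum_sub_distrib,
        ← Finset.sum_add_distrib]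
      refine Finset.sum_congr rfl fun i _ => ?_
      simp only [hδ, _root_.sub_apply, Prod.fst_sub, Prod.snd_sub, Pi.sub_apply]
      ring
    have hterm : ∀ i, ‖δ.2 i * (fderiv ℝ (K s) (ψ s y) - fderiv ℝ (K s) (ψ s x))
        (0, Pi.single i 1)‖ ≤ M * ‖δ‖ ^ 2 := by
      intro i
      have h1 : ‖δ.2 i‖ ≤ ‖δ‖ := (norm_le_pi_norm δ.2 i).trans (norm_snd_le δ)
      have h2 := (fderiv ℝ (K s) (ψ s y) - fderiv ℝ (K s) (ψ s x)).le_opNorm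
        ((0, Pi.single i 1) : Phase m)
      rw [norm_momentum_single, mul_one] at h2
      rw [norm_mul]
      calc _ ≤ ‖δ‖ * (M * ‖δ‖) :=
            mul_le_mul h1 (h2.trans (hlip s hs _ _)) (norm_nonneg _) (norm_nonneg _)
        _ = _ := by ring
    have hsum : ‖∑ i, δ.2 i * (fderiv ℝ (K s) (ψ s y) - fderiv ℝ (K s) (ψ s x))
        (0, Pi.single i 1)‖ ≤ m * (M * ‖δ‖ ^ 2) := by
      refine (norm_sum_le_of_le _ fun i _ => hterm i).trans ?_
      simp
    have htaylor := norm_taylor_remainder_le hM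
      (fun z => (hasFDerivAt_slice hdiff s z).differentiableAt) (hlip s hs) (ψ s x) (ψ s y)
    have hδle : ‖δ‖ ^ 2 ≤ (Real.exp M * ‖y - x‖) ^ 2 :=
      pow_le_pow_left₀ (norm_nonneg _) (hψ.norm_sub_le hM hlip x y hs) 2
    rw [hrem]
    calc _ ≤ m * (M * ‖δ‖ ^ 2) + M * ‖δ‖ ^ 2 := (_root_.norm_sub_le _ _).trans (add_le_add hsum htaylor)
      _ = (m + 1) * M * ‖δ‖ ^ 2 := by ring
      _ ≤ (m + 1) * M * (Real.exp M * ‖y - x‖) ^ 2 :=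
        mul_le_mul_of_nonneg_left hδle (by positivity)
      _ = _ := by ring
  have := intervalIntegral.norm_integral_le_of_norm_le_const (a := (0 : ℝ)) (b := 1)
    (f := fun s => L y s - L x s - h' s) fun s hs => hbd s (by
      rw [uIoc_of_le zero_le_one] at hs
      exact ⟨hs.1.le, hs.2⟩)
  simpa using this

/-- If the Hamiltonian and its flow are 1-periodic in time, then the action over one more period
adds the action over `[0, 1]`. -/
theorem actF_add_one (hψ : IsHamFlow m K ψ) (hK : ContDiff ℝ 2 (Function.uncurry K))
    (hKper : ∀ (t : ℝ) (z : Phase m), K (t + 1) z = K t z)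
    (hψper : ∀ (t : ℝ) (z : Phase m), ψ (t + 1) z = ψ t z) (t : ℝ) (x : Phase m) :
    actF m K ψ (t + 1) x = actF m K ψ t x + actF m K ψ 1 x := by
  have hc := hψ.continuous_actionIntegrand hK x
  have hper : Function.Periodic (fun s =>
      (∑ i, (ψ s x).2 i * deriv (fun u => (ψ u x).1 i) s) - K s (ψ s x)) 1 := by
    intro s
    have hd : ∀ i, deriv (fun u => (ψ u x).1 i) (s + 1) = deriv (fun u => (ψ u x).1 i) s := by
      intro i
      rw [← deriv_comp_add_const]
      simp_rw [hψper]
    simp only [hd, hψper, hKper]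
  have := hper.intervalIntegral_add_eq_add 0 t fun a b => hc.intervalIntegrable a b
  rw [zero_add] at this
  exact this

end IsHamFlow

/-- Let `K` be a compactly supported `C^2` Hamiltonian on `T^*ℝ^m`,
1-periodic in time, whose flow satisfies `ψ^{t+1} = ψ^t` (in particular
`ψ^1 = ψ^0 = id`), and let `F` be the classical action. Then there is a constant `c`
with `F(t+1, x) = F(t, x) + c` for all `t` and `x`; consequently, after shifting the
Hamiltonian by the constant (i.e. subtracting `c·t` from `F`), the action becomes
1-periodic in `t`. -/
theorem action_periodic_up_to_constant
    (m : ℕ) (K : ℝ → Phase m → ℝ) (ψ : ℝ → Phase m → Phase m)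
    (hK : ContDiff ℝ 2 (Function.uncurry K))
    (hKsupp : CompactlySupported m K)
    (hKper : ∀ (t : ℝ) (z : Phase m), K (t + 1) z = K t z)
    (hψ : IsHamFlow m K ψ)
    (hψper : ∀ (t : ℝ) (z : Phase m), ψ (t + 1) z = ψ t z) :
    ∃ c : ℝ,
      (∀ (t : ℝ) (x : Phase m), actF m K ψ (t + 1) x = actF m K ψ t x + c) ∧
      (∀ x : Phase m, Function.Periodic (fun t => actF m K ψ t x - c * t) 1) := by
  obtain ⟨M, hM, hlip⟩ := exists_lipschitz_fderiv_slice hK hKsupp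
  have hclosed : ∀ z, ψ 1 z = z := fun z => by
    have := hψper 0 z
    rwa [zero_add, hψ.1] at this
  have hconst : ∀ x, actF m K ψ 1 x = actF m K ψ 1 0 := fun x =>
    eq_of_norm_sub_le_sq (hψ.norm_actF_sub_le hK hclosed hM hlip) x 0
  have hadd : ∀ (t : ℝ) (x : Phase m),
      actF m K ψ (t + 1) x = actF m K ψ t x + actF m K ψ 1 0 := fun t x => by
    rw [hψ.actF_add_one hK hKper hψper, hconst x]
  refine ⟨actF m K ψ 1 0, hadd, fun x t => ?_⟩
  simp only [hadd]
  ring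
end
end
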